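/- arXiv:1903.03673 — 9 statements merged into one kernel-verified Lean document; each statement's English description precedes it below -/
import Mathlib

section
/- Let n ≥ 2. Let Δ = {x : Fin (n-1) → ℝ | ∀ i, x i ≥ 0 and Σ_i x i ≤ 1}, and for x ∈ Δ let φ(x) : Fin n → ℝ be the probability vector with φ(x) i = x i for i < n-1 and φ(x) (n-1) = 1 - Σ_i x i (so φ is an affine bijection from Δ onto the probability simplex P_n). Then (1 / vol(Δ × Δ)) · ∫_{Δ × Δ} EMD(φ(x), φ(y)) d(x,y) = M(n,n), where the integral and vol are with respect to Lebesgue measure on ℝ^(n-1) × ℝ^(n-1). (This is the statement that the expected value of EMD on P_n × P_n with the uniform probability measure is M_n.) -/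
open MeasureTheory

/-- The set of joint distributions with marginals `μ` and `ν`. -/
def transportSet {n : ℕ} (μ ν : Fin n → ℝ) : Set (Fin n → Fin n → ℝ) :=
  {J | (∀ i j, 0 ≤ J i j) ∧ (∀ j, ∑ i, J i j = μ j) ∧ (∀ i, ∑ j, J i j = ν i)}

/-- Transport cost of a plan, with cost `|i - j|` between indices. -/
noncomputable def rcost {n : ℕ} (J : Fin n → Fin n → ℝ) : ℝ :=
  ∑ i : Fin n, ∑ j : Fin n, (((i : ℤ) - (j : ℤ)).natAbs : ℝ) * J i j

/-- The Earth Mover's Distance on `Fin n → ℝ`. -/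
noncomputable def pEMD {n : ℕ} (μ ν : Fin n → ℝ) : ℝ :=
  sInf (rcost '' transportSet μ ν)

/-- The recursively defined expected value `M(p,q)`. -/
noncomputable def Mrec : ℕ → ℕ → ℝ
  | 0, _ => 0
  | _ + 1, 0 => 0
  | p + 1, q + 1 =>
      ((p : ℝ) * Mrec p (q + 1) + (q : ℝ) * Mrec (p + 1) q + |(p : ℝ) - (q : ℝ)|)
        / ((p : ℝ) + (q : ℝ) + 1)
termination_by p q => p + q

/-- The solid parameter simplex `Δ ⊆ ℝ^(n-1)`. -/
def solidSimplex (n : ℕ) : Set (Fin (n - 1) → ℝ) :=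
  {x | (∀ i, 0 ≤ x i) ∧ ∑ i, x i ≤ 1}

/-- The affine parametrization `φ : Δ → P_n`. -/
noncomputable def param (n : ℕ) (x : Fin (n - 1) → ℝ) : Fin n → ℝ :=
  fun i => if h : (i : ℕ) < n - 1 then x ⟨i, h⟩ else 1 - ∑ j, x j


/-- Cumulative distribution: the mass of the first `k` indices. -/
noncomputable def cumul {n : ℕ} (μ : Fin n → ℝ) (k : ℕ) : ℝ :=
  ∑ i : Fin n, if (i : ℕ) < k then μ i else 0

lemma sum_ite_lt_sub {n k : ℕ} (hk : k ≤ n) (h : ℕ → ℝ) :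
    (∑ i : Fin n, if (i : ℕ) < k then h (i + 1) - h i else 0) = h k - h 0 := by
  rw [Fin.sum_univ_eq_sum_range (fun i => if i < k then h (i + 1) - h i else 0) n,
    ← Finset.sum_filter, ← Finset.sum_range_sub]
  congr 1
  ext i
  simp only [Finset.mem_filter, Finset.mem_range]
  omega

lemma sum_fin_sub {n : ℕ} (h : ℕ → ℝ) : ∑ i : Fin n, (h (i + 1) - h i) = h n - h 0 := by
  rw [Fin.sum_univ_eq_sum_range (fun i => h (i + 1) - h i) n, Finset.sum_range_sub]

lemma cumul_zero {n : ℕ} (μ : Fin n → ℝ) : cumul μ 0 = 0 := by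
  simp [cumul]

lemma cumul_self {n : ℕ} (μ : Fin n → ℝ) : cumul μ n = ∑ i, μ i := by
  simp [cumul]

lemma cumul_succ {n : ℕ} (μ : Fin n → ℝ) (i : Fin n) :
    cumul μ (i + 1) = cumul μ i + μ i := by
  have : μ i = ∑ l : Fin n, if l = i then μ l else 0 := by simp
  rw [this, cumul, cumul, ← Finset.sum_add_distrib]
  refine Finset.sum_congr rfl fun l _ => ?_
  rcases lt_trichotomy l i with h | h | h
  · have h' : (l : ℕ) < i := h
    simp [h.ne, h', Nat.lt_succ_of_lt h']
  · simp [h]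
  · have h' : (i : ℕ) < l := h
    simp [h.ne', show ¬ (l : ℕ) < i + 1 by omega, show ¬ (l : ℕ) < i by omega]

lemma cumul_nonneg {n : ℕ} {μ : Fin n → ℝ} (hμ : ∀ i, 0 ≤ μ i) (k : ℕ) : 0 ≤ cumul μ k :=
  Finset.sum_nonneg fun i _ => by split_ifs <;> simp [hμ]

lemma cumul_le_sum {n : ℕ} {μ : Fin n → ℝ} (hμ : ∀ i, 0 ≤ μ i) (k : ℕ) :
    cumul μ k ≤ ∑ i, μ i :=
  Finset.sum_le_sum fun i _ => by split_ifs <;> simp [hμ]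

/-- Indicator of `i < k` as a real number. -/
noncomputable def below (i k : ℕ) : ℝ := if i < k then 1 else 0

lemma natAbs_sub_eq_sum {n i j : ℕ} (hi : i < n) (hj : j < n) :
    (((i : ℤ) - (j : ℤ)).natAbs : ℝ) = ∑ k ∈ Finset.range n, |below i k - below j k| := by
  wlog h : i ≤ j generalizing i j
  · rw [← Int.natAbs_neg, neg_sub, this hj hi (le_of_not_ge h)]
    exact Finset.sum_congr rfl fun k _ => abs_sub_comm _ _
  have h1 : ∀ k, |below i k - below j k| = if k ∈ Finset.Ioc i j then (1 : ℝ) else 0 := by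
    intro k
    simp only [below, Finset.mem_Ioc]
    split_ifs <;> first | omega | simp
  simp only [h1]
  rw [← Finset.sum_filter]
  have h2 : (Finset.range n).filter (· ∈ Finset.Ioc i j) = Finset.Ioc i j := by
    ext k
    simp only [Finset.mem_filter, Finset.mem_range, Finset.mem_Ioc]
    omega
  rw [h2]
  simp only [Finset.sum_const, Nat.card_Ioc, nsmul_eq_mul, mul_one]
  congr 1
  omega

lemma rcost_eq_sum {n : ℕ} (J : Fin n → Fin n → ℝ) :
    rcost J = ∑ k ∈ Finset.range n, ∑ i : Fin n, ∑ j : Fin n, |below i k - below j k| * J i j := by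
  rw [Finset.sum_comm]
  refine Finset.sum_congr rfl fun i _ => ?_
  rw [Finset.sum_comm]
  refine Finset.sum_congr rfl fun j _ => ?_
  rw [natAbs_sub_eq_sum i.2 j.2, Finset.sum_mul]

lemma sum_below_left {n : ℕ} {μ ν : Fin n → ℝ} {J : Fin n → Fin n → ℝ}
    (hJ : J ∈ transportSet μ ν) (k : ℕ) :
    ∑ i : Fin n, ∑ j : Fin n, below i k * J i j = cumul ν k := by
  refine Finset.sum_congr rfl fun i _ => ?_
  rw [← Finset.mul_sum, hJ.2.2 i]
  simp [below]

lemma sum_below_right {n : ℕ} {μ ν : Fin n → ℝ} {J : Fin n → Fin n → ℝ}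
    (hJ : J ∈ transportSet μ ν) (k : ℕ) :
    ∑ i : Fin n, ∑ j : Fin n, below j k * J i j = cumul μ k := by
  rw [Finset.sum_comm]
  refine Finset.sum_congr rfl fun i _ => ?_
  rw [← Finset.mul_sum, hJ.2.1 i]
  simp [below]

lemma le_rcost {n : ℕ} {μ ν : Fin n → ℝ} {J : Fin n → Fin n → ℝ} (hJ : J ∈ transportSet μ ν) :
    ∑ k ∈ Finset.range n, |cumul μ k - cumul ν k| ≤ rcost J := by
  rw [rcost_eq_sum]
  refine Finset.sum_le_sum fun k _ => ?_
  rw [abs_sub_comm, ← sum_below_left hJ, ← sum_below_right hJ, ← Finset.sum_sub_distrib]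
  refine (Finset.abs_sum_le_sum_abs _ _).trans (Finset.sum_le_sum fun i _ => ?_)
  rw [← Finset.sum_sub_distrib]
  refine (Finset.abs_sum_le_sum_abs _ _).trans (Finset.sum_le_sum fun j _ => ?_)
  rw [← sub_mul, abs_mul, abs_of_nonneg (hJ.1 i j)]

/-- The monotone coupling: the mixed second difference of the minimum of the cumulative
distributions. -/
noncomputable def monotonePlan {n : ℕ} (μ ν : Fin n → ℝ) (i j : Fin n) : ℝ :=
  (min (cumul ν (i + 1)) (cumul μ (j + 1)) - min (cumul ν i) (cumul μ (j + 1))) -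
    (min (cumul ν (i + 1)) (cumul μ j) - min (cumul ν i) (cumul μ j))

lemma monotonePlan_mem {n : ℕ} {μ ν : Fin n → ℝ} (hμ : ∀ i, 0 ≤ μ i) (hν : ∀ i, 0 ≤ ν i)
    (h : ∑ i, μ i = ∑ i, ν i) : monotonePlan μ ν ∈ transportSet μ ν := by
  refine ⟨fun i j => ?_, fun j => ?_, fun i => ?_⟩
  · have h1 := cumul_succ ν i
    have h2 := cumul_succ μ j
    have h3 := hμ j
    have h4 := hν i
    simp only [monotonePlan, min_def]
    split_ifs <;> linarith
  · simp only [monotonePlan]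
    rw [Finset.sum_sub_distrib, sum_fin_sub (fun i => min (cumul ν i) (cumul μ (j + 1))),
      sum_fin_sub (fun i => min (cumul ν i) (cumul μ j)), cumul_zero, cumul_self, ← h,
      min_eq_right (cumul_le_sum hμ _), min_eq_right (cumul_le_sum hμ _),
      min_eq_left (cumul_nonneg hμ _), min_eq_left (cumul_nonneg hμ _), cumul_succ]
    ring
  · have h1 : ∀ j : Fin n, monotonePlan μ ν i j =
        (fun j : ℕ => min (cumul ν (i + 1)) (cumul μ j) - min (cumul ν i) (cumul μ j)) (j + 1) -
        (fun j : ℕ => min (cumul ν (i + 1)) (cumul μ j) - min (cumul ν i) (cumul μ j)) j :=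
      fun j => rfl
    simp only [h1]
    rw [sum_fin_sub (fun j : ℕ =>
      min (cumul ν (i + 1)) (cumul μ j) - min (cumul ν i) (cumul μ j))]
    simp only [cumul_zero, cumul_self, h]
    rw [min_eq_left (cumul_le_sum hν _), min_eq_left (cumul_le_sum hν _),
      min_eq_right (cumul_nonneg hν _), min_eq_right (cumul_nonneg hν _), cumul_succ]
    ring

lemma sum_below_below_monotonePlan {n : ℕ} {μ ν : Fin n → ℝ} (hμ : ∀ i, 0 ≤ μ i)
    (hν : ∀ i, 0 ≤ ν i) {k : ℕ} (hk : k ≤ n) :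
    ∑ i : Fin n, ∑ j : Fin n, below i k * below j k * monotonePlan μ ν i j =
      min (cumul ν k) (cumul μ k) := by
  have h1 : ∀ i : Fin n, ∑ j : Fin n, below i k * below j k * monotonePlan μ ν i j =
      if (i : ℕ) < k then min (cumul ν (i + 1)) (cumul μ k) - min (cumul ν i) (cumul μ k)
      else 0 := by
    intro i
    have h2 := sum_ite_lt_sub hk (fun j : ℕ =>
      min (cumul ν (i + 1)) (cumul μ j) - min (cumul ν i) (cumul μ j))
    simp only [cumul_zero] at h2
    rw [min_eq_right (cumul_nonneg hν _), min_eq_right (cumul_nonneg hν _), sub_zero,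
      sub_zero] at h2
    rw [← h2]
    simp only [below, monotonePlan, ite_mul, one_mul, zero_mul]
    split_ifs <;> simp
  simp only [h1]
  rw [sum_ite_lt_sub hk (fun i => min (cumul ν i) (cumul μ k)), cumul_zero,
    min_eq_left (cumul_nonneg hμ _), sub_zero]

lemma rcost_monotonePlan {n : ℕ} {μ ν : Fin n → ℝ} (hμ : ∀ i, 0 ≤ μ i) (hν : ∀ i, 0 ≤ ν i)
    (h : ∑ i, μ i = ∑ i, ν i) :
    rcost (monotonePlan μ ν) = ∑ k ∈ Finset.range n, |cumul μ k - cumul ν k| := by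
  have hJ := monotonePlan_mem hμ hν h
  rw [rcost_eq_sum]
  refine Finset.sum_congr rfl fun k hk => ?_
  have h1 : ∀ i j : ℕ, ∀ c : ℝ, |below i k - below j k| * c =
      below i k * c + below j k * c - 2 * (below i k * below j k * c) := by
    intro i j c
    simp only [below]
    split_ifs <;> norm_num
    ring
  simp only [h1, Finset.sum_sub_distrib, Finset.sum_add_distrib]
  simp only [← Finset.mul_sum _ _ (2 : ℝ)]
  rw [sum_below_below_monotonePlan hμ hν (Finset.mem_range.1 hk).le, sum_below_left hJ,
    sum_below_right hJ]
  rcases le_total (cumul μ k) (cumul ν k) with h2 | h2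
  · rw [min_eq_right h2, abs_of_nonpos (by linarith)]
    ring
  · rw [min_eq_left h2, abs_of_nonneg (by linarith)]
    ring

/-- The Earth Mover's Distance is the `ℓ¹` distance of the cumulative distributions. -/
lemma pEMD_eq_sum {n : ℕ} {μ ν : Fin n → ℝ} (hμ : ∀ i, 0 ≤ μ i) (hν : ∀ i, 0 ≤ ν i)
    (h : ∑ i, μ i = ∑ i, ν i) :
    pEMD μ ν = ∑ k ∈ Finset.range n, |cumul μ k - cumul ν k| := by
  refine IsLeast.csInf_eq ⟨⟨_, monotonePlan_mem hμ hν h, rcost_monotonePlan hμ hν h⟩, ?_⟩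
  rintro _ ⟨J, hJ, rfl⟩
  exact le_rcost hJ

lemma integral_pow_mul_one_sub_pow (a b : ℕ) :
    ∫ t in (0 : ℝ)..1, t ^ a * (1 - t) ^ b =
      (a.factorial * b.factorial : ℝ) / (a + b + 1).factorial := by
  induction b generalizing a with
  | zero =>
    simp only [pow_zero, mul_one, integral_pow, one_pow, Nat.factorial_succ]
    have := Nat.factorial_ne_zero a
    push_cast
    field_simp
    simp
  | succ b ih =>
    have h1 : ∀ t ∈ Set.uIcc (0 : ℝ) 1,
        HasDerivAt (fun t : ℝ => (1 - t) ^ (b + 1)) (-((b + 1) * (1 - t) ^ b)) t := by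
      intro t _
      exact (((hasDerivAt_id t).const_sub 1).pow (b + 1)).congr_deriv (by simp)
    have h2 : ∀ t ∈ Set.uIcc (0 : ℝ) 1,
        HasDerivAt (fun t : ℝ => t ^ (a + 1) / (a + 1)) (t ^ a) t := by
      intro t _
      refine ((hasDerivAt_pow (a + 1) t).div_const ((a : ℝ) + 1)).congr_deriv ?_
      have : (a : ℝ) + 1 ≠ 0 := by positivity
      push_cast
      field_simp
    have h3 := intervalIntegral.integral_mul_deriv_eq_deriv_mul h1 h2
      (Continuous.intervalIntegrable (by fun_prop) _ _)
      (Continuous.intervalIntegrable (by fun_prop) _ _)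
    have h4 : ∀ t : ℝ, -((b + 1) * (1 - t) ^ b) * (t ^ (a + 1) / (a + 1)) =
        -((b + 1) / (a + 1)) * (t ^ (a + 1) * (1 - t) ^ b) := fun t => by ring
    simp only [h4, intervalIntegral.integral_const_mul, ih (a + 1)] at h3
    simp only [mul_comm (_ ^ a)]
    rw [h3]
    have h5 : a + 1 + b + 1 = a + (b + 1) + 1 := by ring
    rw [h5, Nat.factorial_succ a, Nat.factorial_succ b]
    have : (a : ℝ) + 1 ≠ 0 := by positivity
    push_cast
    field_simp
    simp

/-- The probability that `i` and `j` points fall below a uniform random threshold among two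
independent samples of `r` and `s` uniform random points. -/
noncomputable def splitWeight (r s i j : ℕ) : ℝ :=
  r.choose i * s.choose j * ((i + j).factorial * (r + s - (i + j)).factorial) /
    (r + s + 1).factorial

lemma mul_choose_pred (r i : ℕ) : (r : ℝ) * ((r - 1).choose i : ℝ) = (r - i) * r.choose i := by
  rcases r with _ | r
  · rcases i with _ | i <;> simp
  rcases lt_or_ge (r + 1) i with h | h
  · simp [Nat.choose_eq_zero_of_lt h, Nat.choose_eq_zero_of_lt (show r < i by omega)]
  · have h1 := Nat.choose_mul_succ_eq r i
    rw [← Nat.cast_sub h]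
    simp only [Nat.add_sub_cancel]
    exact_mod_cast (by linarith : (r + 1) * r.choose i = (r + 1 - i) * (r + 1).choose i)

lemma splitWeight_rec (r s i j : ℕ) (hi : i ≤ r) (hj : j ≤ s) :
    (r + s + 1) * splitWeight r s i j =
      r * splitWeight (r - 1) s i j + s * splitWeight r (s - 1) i j +
        if i = r ∧ j = s then 1 else 0 := by
  have e1 : (r : ℝ) * splitWeight (r - 1) s i j = (r - i) * r.choose i * s.choose j *
      ((i + j).factorial * (r + s - 1 - (i + j)).factorial) / (r + s).factorial := by
    rw [← mul_choose_pred, splitWeight]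
    rcases r with _ | r
    · simp
    · rw [show r + 1 - 1 + s = r + 1 + s - 1 by omega, show r + 1 + s - 1 + 1 = r + 1 + s by omega]
      ring
  have e2 : (s : ℝ) * splitWeight r (s - 1) i j = (s - j) * r.choose i * s.choose j *
      ((i + j).factorial * (r + s - 1 - (i + j)).factorial) / (r + s).factorial := by
    rw [mul_assoc (_ - _ : ℝ), mul_comm (r.choose i : ℝ), ← mul_assoc (_ - _ : ℝ),
      ← mul_choose_pred, splitWeight]
    rcases s with _ | s
    · simp
    · rw [show r + (s + 1 - 1) = r + (s + 1) - 1 by omega,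
        show r + (s + 1) - 1 + 1 = r + (s + 1) by omega]
      ring
  rw [e1, e2, splitWeight, Nat.factorial_succ]
  have h0 : ((r + s).factorial : ℝ) ≠ 0 := by exact_mod_cast Nat.factorial_ne_zero _
  have h1 : (r : ℝ) + s + 1 ≠ 0 := by positivity
  push_cast
  by_cases h : i = r ∧ j = s
  · obtain ⟨rfl, rfl⟩ := h
    simp
    field_simp
  · rw [if_neg h]
    obtain ⟨d, hd⟩ : ∃ d, r + s = i + j + d + 1 := ⟨r + s - (i + j) - 1, by omega⟩
    have hd' : (r : ℝ) + s = i + j + d + 1 := by exact_mod_cast hd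
    rw [show r + s - (i + j) = d + 1 by omega, show r + s - 1 - (i + j) = d by omega,
      Nat.factorial_succ d]
    have h3 : (d : ℝ) + 1 = (r - i) + (s - j) := by linarith
    push_cast
    rw [h3]
    field_simp
    ring

lemma sum_splitWeight_pad {r s R S : ℕ} (hr : r ≤ R) (hs : s ≤ S) :
    ∑ i ∈ Finset.range (R + 1), ∑ j ∈ Finset.range (S + 1),
      |(i : ℝ) - j| * splitWeight r s i j =
    ∑ i ∈ Finset.range (r + 1), ∑ j ∈ Finset.range (s + 1),
      |(i : ℝ) - j| * splitWeight r s i j := by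
  symm
  have h1 : ∀ i : ℕ, ∑ j ∈ Finset.range (s + 1), |(i : ℝ) - j| * splitWeight r s i j =
      ∑ j ∈ Finset.range (S + 1), |(i : ℝ) - j| * splitWeight r s i j := by
    intro i
    refine Finset.sum_subset (Finset.range_subset_range.2 (by omega)) fun j _ hj => ?_
    rw [Finset.mem_range] at hj
    simp [splitWeight, Nat.choose_eq_zero_of_lt (show s < j by omega)]
  simp only [h1]
  refine Finset.sum_subset (Finset.range_subset_range.2 (by omega)) fun i _ hi => ?_
  rw [Finset.mem_range] at hi
  simp [splitWeight, Nat.choose_eq_zero_of_lt (show r < i by omega)]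

/-- Closed form of the recursion: the expected difference of the two sample counts below a
uniform random threshold. -/
lemma Mrec_succ_succ (r s : ℕ) : Mrec (r + 1) (s + 1) =
    ∑ i ∈ Finset.range (r + 1), ∑ j ∈ Finset.range (s + 1),
      |(i : ℝ) - j| * splitWeight r s i j := by
  induction hN : r + s using Nat.strong_induction_on generalizing r s with
  | _ N ih =>
  subst hN
  have h0 : (r : ℝ) + s + 1 ≠ 0 := by positivity
  have h1 : (r : ℝ) * Mrec r (s + 1) = r * ∑ i ∈ Finset.range (r + 1),
      ∑ j ∈ Finset.range (s + 1), |(i : ℝ) - j| * splitWeight (r - 1) s i j := by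
    rcases r with _ | r
    · simp
    · rw [ih (r + s) (by omega) r s rfl, ← sum_splitWeight_pad (Nat.le_succ r) le_rfl]
      rfl
  have h2 : (s : ℝ) * Mrec (r + 1) s = s * ∑ i ∈ Finset.range (r + 1),
      ∑ j ∈ Finset.range (s + 1), |(i : ℝ) - j| * splitWeight r (s - 1) i j := by
    rcases s with _ | s
    · simp
    · rw [ih (r + s) (by omega) r s rfl, ← sum_splitWeight_pad le_rfl (Nat.le_succ s)]
      rfl
  have h3 : |(r : ℝ) - s| = ∑ i ∈ Finset.range (r + 1), ∑ j ∈ Finset.range (s + 1),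
      |(i : ℝ) - j| * if i = r ∧ j = s then 1 else 0 := by
    rw [Finset.sum_eq_single_of_mem r (by simp), Finset.sum_eq_single_of_mem s (by simp)]
    · simp
    · intro j _ hj
      simp [hj]
    · intro i _ hi
      simp [hi]
  rw [Mrec, h1, h2, h3, div_eq_iff h0, mul_comm _ ((r : ℝ) + s + 1)]
  simp only [Finset.mul_sum, ← Finset.sum_add_distrib]
  refine Finset.sum_congr rfl fun i hi => Finset.sum_congr rfl fun j hj => ?_
  rw [Finset.mem_range] at hi hj
  have := splitWeight_rec r s i j (by omega) (by omega)
  linear_combination (-|(i : ℝ) - j|) * this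

/-- The number of partial sums of `x` that are at most `t`. -/
noncomputable def belowCount {m : ℕ} (t : ℝ) (x : Fin m → ℝ) : ℕ :=
  ∑ k : Fin m, if cumul x (k + 1) ≤ t then 1 else 0

/-- The part of the simplex of size `s` on which exactly `j` partial sums are at most `t`. -/
def simplexCell (m j : ℕ) (t s : ℝ) : Set (Fin m → ℝ) :=
  {x | (∀ i, 0 ≤ x i) ∧ ∑ i, x i ≤ s ∧ belowCount t x = j}

lemma cumul_cons {m : ℕ} (a : ℝ) (y : Fin m → ℝ) (k : ℕ) :
    cumul (Fin.cons a y : Fin (m + 1) → ℝ) (k + 1) = a + cumul y k := by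
  simp [cumul, Fin.sum_univ_succ]

lemma belowCount_cons {m : ℕ} (t a : ℝ) (y : Fin m → ℝ) :
    belowCount t (Fin.cons a y : Fin (m + 1) → ℝ) =
      (if a ≤ t then 1 else 0) + belowCount (t - a) y := by
  simp only [belowCount, Fin.sum_univ_succ, cumul_cons, Fin.val_zero, Fin.val_succ, cumul_zero,
    add_zero, le_sub_iff_add_le']

lemma belowCount_le {m : ℕ} (t : ℝ) (x : Fin m → ℝ) : belowCount t x ≤ m := by
  calc belowCount t x ≤ ∑ _ : Fin m, 1 :=
        Finset.sum_le_sum fun _ _ => by split_ifs <;> simp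
    _ = m := by simp

lemma belowCount_of_neg {m : ℕ} {t : ℝ} (ht : t < 0) {x : Fin m → ℝ} (hx : ∀ i, 0 ≤ x i) :
    belowCount t x = 0 :=
  Finset.sum_eq_zero fun _ _ => if_neg (not_le.2 (ht.trans_le (cumul_nonneg hx _)))

lemma belowCount_of_sum_le {m : ℕ} {t : ℝ} {x : Fin m → ℝ} (hx : ∀ i, 0 ≤ x i)
    (ht : ∑ i, x i ≤ t) : belowCount t x = m := by
  have h : ∀ k : Fin m, cumul x (k + 1) ≤ t := fun k => (cumul_le_sum hx _).trans ht
  simp [belowCount, h]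

lemma measurable_cumul (m k : ℕ) : Measurable fun x : Fin m → ℝ => cumul x k := by
  refine Finset.measurable_sum _ fun i _ => ?_
  split_ifs
  · exact measurable_pi_apply i
  · exact measurable_const

lemma Measurable.belowCount {α : Type*} [MeasurableSpace α] {m : ℕ} {g : α → ℝ}
    {f : α → Fin m → ℝ} (hg : Measurable g) (hf : Measurable f) :
    Measurable fun w => belowCount (g w) (f w) := by
  unfold _root_.belowCount
  refine Finset.measurable_sum _ fun k _ => Measurable.ite ?_ measurable_const measurable_const
  exact measurableSet_le ((measurable_cumul m (k + 1)).comp hf) hg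

lemma measurableSet_simplex (m : ℕ) (s : ℝ) :
    MeasurableSet {x : Fin m → ℝ | (∀ i, 0 ≤ x i) ∧ ∑ i, x i ≤ s} := by
  have h : {x : Fin m → ℝ | (∀ i, 0 ≤ x i) ∧ ∑ i, x i ≤ s} =
      (⋂ i, {x | 0 ≤ x i}) ∩ {x | ∑ i, x i ≤ s} := by
    ext x
    simp
  rw [h]
  exact (MeasurableSet.iInter fun i =>
    measurableSet_le measurable_const (measurable_pi_apply i)).inter
    (measurableSet_le (Finset.measurable_sum _ fun i _ => measurable_pi_apply i) measurable_const)

lemma simplexCell_eq_inter (m j : ℕ) (t s : ℝ) :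
    simplexCell m j t s = {x | (∀ i, 0 ≤ x i) ∧ ∑ i, x i ≤ s} ∩ {x | belowCount t x = j} := by
  ext x
  simp [simplexCell, and_assoc]

lemma measurableSet_simplexCell (m j : ℕ) (t s : ℝ) : MeasurableSet (simplexCell m j t s) := by
  rw [simplexCell_eq_inter]
  exact (measurableSet_simplex m s).inter
    (measurable_const.belowCount measurable_id (MeasurableSet.singleton j))

lemma simplex_eq_simplexCell (m : ℕ) (s : ℝ) :
    {x : Fin m → ℝ | (∀ i, 0 ≤ x i) ∧ ∑ i, x i ≤ s} = simplexCell m m s s := by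
  ext x
  exact ⟨fun h => ⟨h.1, h.2, belowCount_of_sum_le h.1 h.2⟩, fun h => ⟨h.1, h.2.1⟩⟩

lemma cons_mem_simplexCell {m j : ℕ} {t s a : ℝ} {y : Fin m → ℝ} :
    (Fin.cons a y : Fin (m + 1) → ℝ) ∈ simplexCell (m + 1) j t s ↔
      0 ≤ a ∧ (∀ i, 0 ≤ y i) ∧ ∑ i, y i ≤ s - a ∧
        (if a ≤ t then 1 else 0) + belowCount (t - a) y = j := by
  simp only [simplexCell, Set.mem_ofPred_eq, Fin.forall_fin_succ, Fin.cons_zero, Fin.cons_succ,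
    Fin.sum_univ_succ, belowCount_cons, le_sub_iff_add_le', and_assoc]

lemma volume_eq_lintegral_cons {m : ℕ} {S : Set (Fin (m + 1) → ℝ)} (hS : MeasurableSet S) :
    volume S = ∫⁻ a : ℝ, volume {y : Fin m → ℝ | (Fin.cons a y : Fin (m + 1) → ℝ) ∈ S} := by
  have h := (volume_preserving_piFinSuccAbove (fun _ : Fin (m + 1) => ℝ) 0).symm
  rw [← h.measure_preimage hS.nullMeasurableSet, Measure.volume_eq_prod,
    Measure.prod_apply (h.measurable hS)]
  refine lintegral_congr fun a => ?_
  congr 1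
  ext y
  simp [MeasurableEquiv.piFinSuccAbove_symm_apply, Fin.consEquiv]

lemma setLIntegral_sub_pow {c d C : ℝ} (hcd : c ≤ d) (hC : 0 ≤ C) (k : ℕ) :
    ∫⁻ a in Set.Ioc c d, ENNReal.ofReal ((d - a) ^ k / k.factorial * C) =
      ENNReal.ofReal ((d - c) ^ (k + 1) / (k + 1).factorial * C) := by
  have hcont : Continuous fun a : ℝ => (d - a) ^ k / k.factorial * C := by fun_prop
  rw [← ofReal_integral_eq_lintegral_ofReal]
  · rw [← intervalIntegral.integral_of_le hcd, intervalIntegral.integral_mul_const,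
      intervalIntegral.integral_div, intervalIntegral.integral_comp_sub_left (fun x => x ^ k) d,
      sub_self, integral_pow, Nat.factorial_succ]
    push_cast
    congr 2
    field_simp
    simp
  · exact (hcont.integrableOn_Icc).mono_set Set.Ioc_subset_Icc_self
  · refine (ae_restrict_iff' measurableSet_Ioc).2 (ae_of_all _ fun a ha => ?_)
    have : 0 ≤ d - a := sub_nonneg.2 ha.2
    simp only [Pi.zero_apply]
    positivity

lemma volume_simplexCell {m j : ℕ} (hj : j ≤ m) {t s : ℝ} (ht : 0 ≤ t) (hts : t ≤ s) :
    volume (simplexCell m j t s) =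
      ENNReal.ofReal (t ^ j / j.factorial * ((s - t) ^ (m - j) / (m - j).factorial)) := by
  induction m generalizing j t s with
  | zero =>
    obtain rfl : j = 0 := by omega
    have : simplexCell 0 0 t s = Set.univ := by
      ext x
      simp [simplexCell, belowCount, ht.trans hts]
    rw [this]
    simp [volume_pi]
  | succ m ih =>
    rw [volume_eq_lintegral_cons (measurableSet_simplexCell _ _ _ _)]
    simp only [cons_mem_simplexCell]
    rcases j with _ | j
    · have h1 : ∀ a : ℝ, volume {y : Fin m → ℝ | 0 ≤ a ∧ (∀ i, 0 ≤ y i) ∧ ∑ i, y i ≤ s - a ∧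
          (if a ≤ t then 1 else 0) + belowCount (t - a) y = 0} =
          (Set.Ioc t s).indicator (fun a => ENNReal.ofReal ((s - a) ^ m / m.factorial * 1)) a := by
        intro a
        by_cases ha : a ∈ Set.Ioc t s
        · rw [Set.indicator_of_mem ha]
          have h2 := ih le_rfl (sub_nonneg.2 ha.2) (le_refl (s - a))
          rw [← simplex_eq_simplexCell] at h2
          simp only [sub_self, tsub_self, pow_zero, Nat.factorial_zero, Nat.cast_one, div_one] at h2
          rw [← h2]
          congr 1
          ext y
          simp only [Set.mem_ofPred_eq, if_neg (not_le.2 ha.1), zero_add]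
          exact ⟨fun h => ⟨h.2.1, h.2.2.1⟩, fun h => ⟨ht.trans ha.1.le, h.1, h.2,
            belowCount_of_neg (sub_neg.2 ha.1) h.1⟩⟩
        · rw [Set.indicator_of_notMem ha]
          convert measure_empty (μ := volume)
          refine Set.eq_empty_of_forall_notMem fun y hy => ?_
          obtain ⟨-, h2, h3, h4⟩ := hy
          have h5 : t < a := by
            by_contra h
            rw [if_pos (not_lt.1 h)] at h4
            omega
          have h6 : 0 ≤ ∑ i, y i := Finset.sum_nonneg fun i _ => h2 i
          exact ha ⟨h5, by linarith⟩
      simp only [h1]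
      rw [lintegral_indicator measurableSet_Ioc, setLIntegral_sub_pow hts zero_le_one]
      simp
    · have h1 : ∀ a : ℝ, volume {y : Fin m → ℝ | 0 ≤ a ∧ (∀ i, 0 ≤ y i) ∧ ∑ i, y i ≤ s - a ∧
          (if a ≤ t then 1 else 0) + belowCount (t - a) y = j + 1} =
          (Set.Icc 0 t).indicator (fun a => ENNReal.ofReal ((t - a) ^ j / j.factorial *
            ((s - t) ^ (m - j) / (m - j).factorial))) a := by
        intro a
        by_cases ha : a ∈ Set.Icc 0 t
        · rw [Set.indicator_of_mem ha]
          have h2 := ih (Nat.le_of_succ_le_succ hj) (sub_nonneg.2 ha.2) (sub_le_sub_right hts a)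
          rw [sub_sub_sub_cancel_right] at h2
          rw [← h2]
          congr 1
          ext y
          simp only [Set.mem_ofPred_eq, if_pos ha.2, ha.1, true_and, simplexCell, add_comm 1,
            Nat.add_right_cancel_iff]
        · rw [Set.indicator_of_notMem ha]
          convert measure_empty (μ := volume)
          refine Set.eq_empty_of_forall_notMem fun y hy => ?_
          obtain ⟨h1, h2, h3, h4⟩ := hy
          have h5 : t < a := by
            by_contra h
            exact ha ⟨h1, not_lt.1 h⟩
          rw [if_neg (not_le.2 h5), belowCount_of_neg (sub_neg.2 h5) h2] at h4
          omega
      simp only [h1]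
      have hs : 0 ≤ s - t := sub_nonneg.2 hts
      rw [lintegral_indicator measurableSet_Icc, ← setLIntegral_congr Ioc_ae_eq_Icc,
        setLIntegral_sub_pow ht (by positivity), sub_zero, Nat.add_sub_add_right]

lemma integral_abs_step_sub {u v : ℝ} (hu : u ∈ Set.Icc (0 : ℝ) 1) (hv : v ∈ Set.Icc (0 : ℝ) 1) :
    ∫ t in Set.Icc (0 : ℝ) 1, |(if u ≤ t then (1 : ℝ) else 0) - if v ≤ t then 1 else 0| =
      |u - v| := by
  wlog h : u ≤ v generalizing u v
  · rw [abs_sub_comm, ← this hv hu (le_of_not_ge h)]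
    exact integral_congr_ae (ae_of_all _ fun t => abs_sub_comm _ _)
  have h1 : ∀ t : ℝ, |(if u ≤ t then (1 : ℝ) else 0) - if v ≤ t then 1 else 0| =
      (Set.Ico u v).indicator 1 t := by
    intro t
    simp only [Set.indicator_apply, Set.mem_Ico, Pi.one_apply]
    split_ifs <;> grind
  have h2 : Set.Ico u v ⊆ Set.Icc 0 1 := fun t ht => ⟨hu.1.trans ht.1, ht.2.le.trans hv.2⟩
  simp only [h1]
  rw [integral_indicator_one measurableSet_Ico, measureReal_restrict_apply measurableSet_Ico,
    Set.inter_eq_left.2 h2,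
    Real.volume_real_Ico_of_le h, abs_sub_comm, abs_of_nonneg (sub_nonneg.2 h)]

lemma integrable_abs_step_sub (u v : ℝ) :
    IntegrableOn (fun t : ℝ => |(if u ≤ t then (1 : ℝ) else 0) - if v ≤ t then 1 else 0|)
      (Set.Icc 0 1) := by
  refine Integrable.of_bound (C := 1) (Measurable.aestronglyMeasurable ?_) (ae_of_all _ fun t => ?_)
  · have h : ∀ w : ℝ, Measurable fun t : ℝ => if w ≤ t then (1 : ℝ) else 0 := fun w =>
      Measurable.ite (measurableSet_le measurable_const measurable_id) measurable_const
        measurable_const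
    exact ((h u).sub (h v)).norm
  · split_ifs <;> simp

lemma cumul_mono {n : ℕ} {μ : Fin n → ℝ} (hμ : ∀ i, 0 ≤ μ i) : Monotone (cumul μ) := by
  intro k l hkl
  refine Finset.sum_le_sum fun i _ => ?_
  split_ifs
  · exact le_rfl
  · omega
  · exact hμ i
  · exact le_rfl

lemma abs_belowCount_sub {m : ℕ} {x y : Fin m → ℝ} (hx : ∀ i, 0 ≤ x i) (hy : ∀ i, 0 ≤ y i)
    (t : ℝ) : |(belowCount t x : ℝ) - belowCount t y| =
      ∑ k : Fin m, |(if cumul x (k + 1) ≤ t then (1 : ℝ) else 0) -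
        if cumul y (k + 1) ≤ t then 1 else 0| := by
  wlog h : ∀ k : Fin m, cumul x (k + 1) ≤ t → cumul y (k + 1) ≤ t generalizing x y
  · have h' : ∀ k : Fin m, cumul y (k + 1) ≤ t → cumul x (k + 1) ≤ t := by
      push Not at h
      obtain ⟨k, hk1, hk2⟩ := h
      intro l hl
      rcases le_total l k with hlk | hlk
      · exact (cumul_mono hx (Nat.succ_le_succ hlk)).trans hk1
      · exact absurd (hk2.trans_le (cumul_mono hy (Nat.succ_le_succ hlk))) (not_lt.2 hl)
    rw [abs_sub_comm, this hy hx h']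
    exact Finset.sum_congr rfl fun k _ => abs_sub_comm _ _
  rw [abs_sub_comm, belowCount, belowCount]
  push_cast
  rw [← Finset.sum_sub_distrib, abs_of_nonneg]
  · refine Finset.sum_congr rfl fun k _ => ?_
    have := h k
    split_ifs <;> simp_all
  · refine Finset.sum_nonneg fun k _ => ?_
    have := h k
    split_ifs <;> simp_all

lemma param_nonneg {m : ℕ} {x : Fin m → ℝ} (hx : x ∈ solidSimplex (m + 1)) (i : Fin (m + 1)) :
    0 ≤ param (m + 1) x i := by
  unfold param
  split_ifs
  · exact hx.1 _
  · exact sub_nonneg.2 hx.2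

lemma param_castSucc {m : ℕ} (x : Fin m → ℝ) (i : Fin m) :
    param (m + 1) x i.castSucc = x i := by
  simp [param]

lemma sum_param {m : ℕ} (x : Fin m → ℝ) : ∑ i, param (m + 1) x i = 1 := by
  rw [Fin.sum_univ_castSucc]
  simp only [param_castSucc]
  simp [param]

lemma cumul_param {m : ℕ} (x : Fin m → ℝ) {k : ℕ} (hk : k ≤ m) :
    cumul (param (m + 1) x) k = cumul x k := by
  simp only [cumul]
  rw [Fin.sum_univ_castSucc]
  simp [param_castSucc, not_lt.2 hk]

lemma pEMD_param {m : ℕ} {x y : Fin m → ℝ} (hx : x ∈ solidSimplex (m + 1))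
    (hy : y ∈ solidSimplex (m + 1)) :
    pEMD (param (m + 1) x) (param (m + 1) y) =
      ∫ t in Set.Icc (0 : ℝ) 1, |(belowCount t x : ℝ) - belowCount t y| := by
  simp only [abs_belowCount_sub hx.1 hy.1]
  rw [integral_finsetSum _ fun k _ => integrable_abs_step_sub _ _,
    pEMD_eq_sum (param_nonneg hx) (param_nonneg hy) (by rw [sum_param, sum_param]),
    Finset.sum_range_succ', cumul_zero, cumul_zero, sub_zero, abs_zero, add_zero,
    ← Fin.sum_univ_eq_sum_range (fun k => |cumul (param (m + 1) x) (k + 1) -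
      cumul (param (m + 1) y) (k + 1)|)]
  refine Finset.sum_congr rfl fun k _ => ?_
  rw [cumul_param x k.2, cumul_param y k.2, integral_abs_step_sub
    ⟨cumul_nonneg hx.1 _, (cumul_le_sum hx.1 _).trans hx.2⟩
    ⟨cumul_nonneg hy.1 _, (cumul_le_sum hy.1 _).trans hy.2⟩]

lemma solidSimplex_eq_simplexCell (m : ℕ) : solidSimplex (m + 1) = simplexCell m m 1 1 :=
  simplex_eq_simplexCell m 1

lemma volume_solidSimplex (m : ℕ) :
    volume (solidSimplex (m + 1)) = ENNReal.ofReal (1 / m.factorial) := by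
  rw [solidSimplex_eq_simplexCell]
  refine (volume_simplexCell le_rfl zero_le_one le_rfl).trans ?_
  simp

lemma measurableSet_solidSimplex (m : ℕ) : MeasurableSet (solidSimplex (m + 1)) :=
  measurableSet_simplex m 1

lemma setIntegral_belowCount_eq {m i : ℕ} (hi : i ≤ m) {t : ℝ} (ht : t ∈ Set.Icc (0 : ℝ) 1) :
    ∫ x : Fin m → ℝ in solidSimplex (m + 1), (if belowCount t x = i then (1 : ℝ) else 0) =
      t ^ i / i.factorial * ((1 - t) ^ (m - i) / (m - i).factorial) := by
  have hS : MeasurableSet {x : Fin m → ℝ | belowCount t x = i} :=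
    measurable_const.belowCount measurable_id (MeasurableSet.singleton i)
  have h1 : ∀ x : Fin m → ℝ, (if belowCount t x = i then (1 : ℝ) else 0) =
      {x : Fin m → ℝ | belowCount t x = i}.indicator 1 x := fun x => by
    simp [Set.indicator_apply]
  have h2 : {x : Fin m → ℝ | belowCount t x = i} ∩ solidSimplex (m + 1) = simplexCell m i t 1 := by
    rw [Set.inter_comm]
    exact (simplexCell_eq_inter m i t 1).symm
  have h3 : 0 ≤ t := ht.1
  have h4 : 0 ≤ 1 - t := sub_nonneg.2 ht.2
  simp only [h1]
  rw [integral_indicator_one hS, measureReal_restrict_apply hS, h2, measureReal_def,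
    volume_simplexCell hi ht.1 ht.2, ENNReal.toReal_ofReal (by positivity)]

instance isFiniteMeasure_restrict_solidSimplex (m : ℕ) :
    IsFiniteMeasure ((volume : Measure (Fin m → ℝ)).restrict (solidSimplex (m + 1))) := by
  refine isFiniteMeasure_restrict.2 ?_
  have h := volume_solidSimplex m
  exact h.trans_ne ENNReal.ofReal_ne_top

lemma abs_belowCount_sub_eq_sum {m : ℕ} (t : ℝ) (x y : Fin m → ℝ) :
    |(belowCount t x : ℝ) - belowCount t y| =
      ∑ i ∈ Finset.range (m + 1), ∑ j ∈ Finset.range (m + 1), |(i : ℝ) - j| *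
        ((if belowCount t x = i then 1 else 0) * if belowCount t y = j then 1 else 0) := by
  simp [Finset.sum_ite_eq, Nat.lt_succ_of_le (belowCount_le t _)]

lemma integrable_step_belowCount (m i : ℕ) (t : ℝ) :
    IntegrableOn (fun x : Fin m → ℝ => if belowCount t x = i then (1 : ℝ) else 0)
      (solidSimplex (m + 1)) := by
  refine Integrable.of_bound (C := 1) (Measurable.aestronglyMeasurable ?_) (ae_of_all _ fun t => ?_)
  · exact Measurable.ite (measurable_const.belowCount measurable_id (MeasurableSet.singleton i))
      measurable_const measurable_const
  · split_ifs <;> simp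

lemma integral_abs_belowCount_sub (m : ℕ) {t : ℝ} (ht : t ∈ Set.Icc (0 : ℝ) 1) :
    ∫ z, |(belowCount t z.1 : ℝ) - belowCount t z.2|
        ∂((volume : Measure (Fin m → ℝ)).restrict (solidSimplex (m + 1))).prod
          ((volume : Measure (Fin m → ℝ)).restrict (solidSimplex (m + 1))) =
      ∑ i ∈ Finset.range (m + 1), ∑ j ∈ Finset.range (m + 1), |(i : ℝ) - j| *
        ((t ^ i / i.factorial * ((1 - t) ^ (m - i) / (m - i).factorial)) *
          (t ^ j / j.factorial * ((1 - t) ^ (m - j) / (m - j).factorial))) := by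
  have hint := fun i j : ℕ => ((integrable_step_belowCount m i t).mul_prod
    (integrable_step_belowCount m j t)).const_mul |(i : ℝ) - j|
  simp only [abs_belowCount_sub_eq_sum]
  rw [integral_finsetSum _ fun i _ => integrable_finsetSum _ fun j _ => hint i j]
  refine Finset.sum_congr rfl fun i hi => ?_
  rw [integral_finsetSum _ fun j _ => hint i j]
  refine Finset.sum_congr rfl fun j hj => ?_
  rw [Finset.mem_range] at hi hj
  rw [integral_const_mul, integral_prod_mul
    (fun x : Fin m → ℝ => if belowCount t x = i then (1 : ℝ) else 0)
    (fun x : Fin m → ℝ => if belowCount t x = j then (1 : ℝ) else 0)]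
  rw [setIntegral_belowCount_eq (by omega) ht, setIntegral_belowCount_eq (by omega) ht]

lemma integral_split_density {m i j : ℕ} (hi : i ≤ m) (hj : j ≤ m) :
    ∫ t in Set.Icc (0 : ℝ) 1, (t ^ i / i.factorial * ((1 - t) ^ (m - i) / (m - i).factorial)) *
          (t ^ j / j.factorial * ((1 - t) ^ (m - j) / (m - j).factorial)) =
      1 / m.factorial * (1 / m.factorial) * splitWeight m m i j := by
  have h1 : ∀ t : ℝ, (t ^ i / i.factorial * ((1 - t) ^ (m - i) / (m - i).factorial)) *
      (t ^ j / j.factorial * ((1 - t) ^ (m - j) / (m - j).factorial)) =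
      1 / (i.factorial * (m - i).factorial * (j.factorial * (m - j).factorial)) *
        (t ^ (i + j) * (1 - t) ^ (m + m - (i + j))) := by
    intro t
    rw [show m + m - (i + j) = (m - i) + (m - j) by omega, pow_add, pow_add]
    field_simp
  simp only [h1]
  rw [integral_const_mul, integral_Icc_eq_integral_Ioc, ← intervalIntegral.integral_of_le
    zero_le_one, integral_pow_mul_one_sub_pow, splitWeight, Nat.cast_choose ℝ hi,
    Nat.cast_choose ℝ hj, show i + j + (m + m - (i + j)) + 1 = m + m + 1 by omega]
  field_simp

lemma integral_pEMD_param (m : ℕ) :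
    ∫ z, pEMD (param (m + 1) z.1) (param (m + 1) z.2)
        ∂((volume : Measure (Fin m → ℝ)).restrict (solidSimplex (m + 1))).prod
          ((volume : Measure (Fin m → ℝ)).restrict (solidSimplex (m + 1))) =
      1 / m.factorial * (1 / m.factorial) * Mrec (m + 1) (m + 1) := by
  set ρ := (volume : Measure (Fin m → ℝ)).restrict (solidSimplex (m + 1)) with hρ
  have hmem : ∀ᵐ z ∂ρ.prod ρ, z ∈ solidSimplex (m + 1) ×ˢ solidSimplex (m + 1) := by
    rw [hρ, Measure.prod_restrict]
    exact ae_restrict_mem ((measurableSet_solidSimplex m).prod (measurableSet_solidSimplex m))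
  have hmeas : ∀ f : (Fin m → ℝ) × (Fin m → ℝ) → (Fin m → ℝ), Measurable f →
      Measurable fun w : ((Fin m → ℝ) × (Fin m → ℝ)) × ℝ => (belowCount w.2 (f w.1) : ℝ) := by
    intro f hf
    exact measurable_from_nat.comp (measurable_snd.belowCount (hf.comp measurable_fst))
  have hint : Integrable (Function.uncurry fun (z : (Fin m → ℝ) × (Fin m → ℝ)) (t : ℝ) =>
      |(belowCount t z.1 : ℝ) - belowCount t z.2|)
      ((ρ.prod ρ).prod (volume.restrict (Set.Icc (0 : ℝ) 1))) := by
    refine Integrable.of_bound (C := m) (Measurable.aestronglyMeasurable ?_)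
      (ae_of_all _ fun w => ?_)
    · exact ((hmeas _ measurable_fst).sub (hmeas _ measurable_snd)).norm
    · have h1 : (belowCount w.2 w.1.1 : ℝ) ≤ m := by exact_mod_cast belowCount_le _ _
      have h2 : (belowCount w.2 w.1.2 : ℝ) ≤ m := by exact_mod_cast belowCount_le _ _
      have h3 : (0 : ℝ) ≤ belowCount w.2 w.1.1 := Nat.cast_nonneg _
      have h4 : (0 : ℝ) ≤ belowCount w.2 w.1.2 := Nat.cast_nonneg _
      rw [Function.uncurry_def, Real.norm_eq_abs, abs_abs, abs_le]
      constructor <;> linarith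
  calc ∫ z, pEMD (param (m + 1) z.1) (param (m + 1) z.2) ∂ρ.prod ρ
      = ∫ z, (∫ t in Set.Icc (0 : ℝ) 1, |(belowCount t z.1 : ℝ) - belowCount t z.2|) ∂ρ.prod ρ :=
        integral_congr_ae (hmem.mono fun z hz => pEMD_param hz.1 hz.2)
    _ = ∫ t in Set.Icc (0 : ℝ) 1, ∫ z, |(belowCount t z.1 : ℝ) - belowCount t z.2| ∂ρ.prod ρ :=
        integral_integral_swap hint
    _ = ∫ t in Set.Icc (0 : ℝ) 1, ∑ i ∈ Finset.range (m + 1), ∑ j ∈ Finset.range (m + 1),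
          |(i : ℝ) - j| * ((t ^ i / i.factorial * ((1 - t) ^ (m - i) / (m - i).factorial)) *
          (t ^ j / j.factorial * ((1 - t) ^ (m - j) / (m - j).factorial))) :=
        setIntegral_congr_fun measurableSet_Icc fun t ht => integral_abs_belowCount_sub m ht
    _ = 1 / m.factorial * (1 / m.factorial) * Mrec (m + 1) (m + 1) := by
        have hcont : ∀ i j : ℕ, IntegrableOn (fun t : ℝ => |(i : ℝ) - j| *
            ((t ^ i / i.factorial * ((1 - t) ^ (m - i) / (m - i).factorial)) *
            (t ^ j / j.factorial * ((1 - t) ^ (m - j) / (m - j).factorial)))) (Set.Icc 0 1) :=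
          fun i j => Continuous.integrableOn_Icc (by fun_prop)
        rw [integral_finsetSum _ fun i _ => integrable_finsetSum _ fun j _ => hcont i j,
          Mrec_succ_succ, Finset.mul_sum]
        refine Finset.sum_congr rfl fun i hi => ?_
        rw [integral_finsetSum _ fun j _ => hcont i j, Finset.mul_sum]
        refine Finset.sum_congr rfl fun j hj => ?_
        rw [Finset.mem_range] at hi hj
        rw [integral_const_mul, integral_split_density (by omega) (by omega)]
        ring

/-- The expected value of the Earth Mover's Distance on `P_n × P_n` with the uniform
probability measure is `M(n,n)`. -/
theorem expected_value_EMD (n : ℕ) (hn : 2 ≤ n) :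
    (volume (solidSimplex n ×ˢ solidSimplex n)).toReal⁻¹ *
      ∫ z in solidSimplex n ×ˢ solidSimplex n, pEMD (param n z.1) (param n z.2) =
    Mrec n n := by
  obtain ⟨m, rfl⟩ : ∃ m, n = m + 1 := ⟨n - 1, by omega⟩
  have hvol := volume_solidSimplex m
  have hint := integral_pEMD_param m
  rw [Measure.prod_restrict] at hint
  rw [Measure.volume_eq_prod, Measure.prod_prod]
  change (volume (solidSimplex (m + 1)) * volume (solidSimplex (m + 1))).toReal⁻¹ * _ = _
  rw [ENNReal.toReal_mul, hvol, ENNReal.toReal_ofReal (by positivity)]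
  refine (congrArg _ hint).trans ?_
  have : (m.factorial : ℝ) ≠ 0 := by exact_mod_cast m.factorial_ne_zero
  field_simp
end

section
/- For all integers p, q ≥ 1, the limit as s → ∞ of N(p,q;s) / (s · C(s+p-1, p-1) · C(s+q-1, q-1)) exists and equals M(p,q). That is, the expected value of the normalized discrete Earth Mover's Distance (1/s)·EMD(μ,ν) over uniformly random pairs (μ,ν) ∈ C(s,p) × C(s,q) converges to M(p,q) as s → ∞. -/
/-- Transport cost of a discrete plan, with cost `|i - j|` between indices. -/
def discCost {p q : ℕ} (J : Fin p → Fin q → ℕ) : ℕ :=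
  ∑ i : Fin p, ∑ j : Fin q, ((i : ℤ) - (j : ℤ)).natAbs * J i j

/-- The discrete Earth Mover's Distance between compositions. -/
noncomputable def discEMD {p q : ℕ} (μ : Fin p → ℕ) (ν : Fin q → ℕ) : ℕ :=
  sInf {c | ∃ J : Fin p → Fin q → ℕ,
    (∀ i, ∑ j, J i j = μ i) ∧ (∀ j, ∑ i, J i j = ν j) ∧ c = discCost J}

/-- `N(p,q;s)`: the sum of the discrete EMD over all pairs of compositions of `s`
into `p` and `q` parts. -/
noncomputable def Nsum (p q s : ℕ) : ℕ :=
  ∑ μ ∈ Finset.Nat.antidiagonalTuple p s, ∑ ν ∈ Finset.Nat.antidiagonalTuple q s, discEMD μ ν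

/-- The matrices with nonnegative integer entries that transport `μ` to `ν`. -/
def IsDiscPlan {p q : ℕ} (μ : Fin p → ℕ) (ν : Fin q → ℕ) (J : Fin p → Fin q → ℕ) : Prop :=
  (∀ i, ∑ j, J i j = μ i) ∧ (∀ j, ∑ i, J i j = ν j)

/-- The matrix moving one unit of mass from `i` to `j`. -/
def unitPlan {p q : ℕ} (i : Fin p) (j : Fin q) : Fin p → Fin q → ℕ :=
  Pi.single i (Pi.single j 1)

lemma sum_row_add_unitPlan {p q : ℕ} (J : Fin p → Fin q → ℕ) (i : Fin p) (j : Fin q)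
    (k : Fin p) :
    ∑ l, (J + unitPlan i j) k l = ∑ l, J k l + (Pi.single i 1 : Fin p → ℕ) k := by
  simp only [Pi.add_apply, Finset.sum_add_distrib, unitPlan]
  congr 1
  by_cases h : k = i
  · subst h; simp
  · simp [Pi.single_eq_of_ne h]

lemma sum_col_add_unitPlan {p q : ℕ} (J : Fin p → Fin q → ℕ) (i : Fin p) (j : Fin q)
    (l : Fin q) :
    ∑ k, (J + unitPlan i j) k l = ∑ k, J k l + (Pi.single j 1 : Fin q → ℕ) l := by
  simp only [Pi.add_apply, Finset.sum_add_distrib, unitPlan]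
  congr 1
  rw [Finset.sum_eq_single i]
  · simp
  · intro k _ hk; simp [Pi.single_eq_of_ne hk]
  · simp

lemma discCost_add_unitPlan {p q : ℕ} (J : Fin p → Fin q → ℕ) (i : Fin p) (j : Fin q) :
    discCost (J + unitPlan i j) = discCost J + ((i : ℤ) - (j : ℤ)).natAbs := by
  simp only [discCost, Pi.add_apply, mul_add, Finset.sum_add_distrib, unitPlan]
  congr 1
  rw [Finset.sum_eq_single i, Finset.sum_eq_single j]
  · simp
  · intro l _ hl; simp [Pi.single_eq_of_ne hl]
  · simp
  · intro k _ hk; simp [Pi.single_eq_of_ne hk]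
  · simp

lemma isDiscPlan_add_unitPlan {p q : ℕ} {μ : Fin p → ℕ} {ν : Fin q → ℕ}
    {J : Fin p → Fin q → ℕ} (i : Fin p) (j : Fin q) :
    IsDiscPlan (μ + Pi.single i 1) (ν + Pi.single j 1) (J + unitPlan i j) ↔
      IsDiscPlan μ ν J := by
  simp only [IsDiscPlan, sum_row_add_unitPlan, sum_col_add_unitPlan]
  simp

lemma exists_eq_add_single {p : ℕ} {μ : Fin p → ℕ} {i : Fin p} (h : 0 < μ i) :
    ∃ μ' : Fin p → ℕ, μ = μ' + Pi.single i 1 := by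
  refine ⟨μ - Pi.single i 1, ?_⟩
  ext k
  by_cases hk : k = i
  · subst hk; simp; omega
  · simp [Pi.single_eq_of_ne hk]

lemma exists_eq_add_unitPlan {p q : ℕ} {J : Fin p → Fin q → ℕ} {i : Fin p} {j : Fin q}
    (h : 0 < J i j) : ∃ K : Fin p → Fin q → ℕ, J = K + unitPlan i j := by
  refine ⟨J - unitPlan i j, ?_⟩
  ext k l
  by_cases hk : k = i
  · subst hk
    by_cases hl : l = j
    · subst hl; simp [unitPlan]; omega
    · simp [unitPlan, Pi.single_eq_of_ne hl]
  · simp [unitPlan, Pi.single_eq_of_ne hk]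

lemma exists_isDiscPlan {p q : ℕ} (s : ℕ) (μ : Fin p → ℕ) (ν : Fin q → ℕ)
    (hμ : ∑ i, μ i = s) (hν : ∑ j, ν j = s) : ∃ J, IsDiscPlan μ ν J := by
  induction s generalizing μ ν with
  | zero =>
    simp only [Finset.sum_eq_zero_iff, Finset.mem_univ, true_implies] at hμ hν
    exact ⟨0, by simp [IsDiscPlan, hμ, hν]⟩
  | succ s ih =>
    obtain ⟨i, -, hi⟩ : ∃ i ∈ Finset.univ, μ i ≠ 0 := by
      apply Finset.exists_ne_zero_of_sum_ne_zero; omega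
    obtain ⟨j, -, hj⟩ : ∃ j ∈ Finset.univ, ν j ≠ 0 := by
      apply Finset.exists_ne_zero_of_sum_ne_zero; omega
    obtain ⟨μ', rfl⟩ := exists_eq_add_single (Nat.pos_of_ne_zero hi)
    obtain ⟨ν', rfl⟩ := exists_eq_add_single (Nat.pos_of_ne_zero hj)
    simp only [Pi.add_apply, Finset.sum_add_distrib, Finset.sum_pi_single', Finset.mem_univ,
      if_true, Nat.add_right_cancel_iff] at hμ hν
    obtain ⟨J, hJ⟩ := ih μ' ν' hμ hν
    exact ⟨_, (isDiscPlan_add_unitPlan i j).2 hJ⟩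

lemma discEMD_le {p q : ℕ} {μ : Fin p → ℕ} {ν : Fin q → ℕ} {J : Fin p → Fin q → ℕ}
    (hJ : IsDiscPlan μ ν J) : discEMD μ ν ≤ discCost J :=
  Nat.sInf_le ⟨J, hJ.1, hJ.2, rfl⟩

lemma exists_discCost_eq_discEMD {p q : ℕ} {μ : Fin p → ℕ} {ν : Fin q → ℕ}
    (h : ∑ i, μ i = ∑ j, ν j) : ∃ J, IsDiscPlan μ ν J ∧ discCost J = discEMD μ ν := by
  obtain ⟨J, hJ⟩ := exists_isDiscPlan _ μ ν h rfl
  obtain ⟨K, h₁, h₂, h₃⟩ := Nat.sInf_mem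
    (s := {c | ∃ J : Fin p → Fin q → ℕ,
      (∀ i, ∑ j, J i j = μ i) ∧ (∀ j, ∑ i, J i j = ν j) ∧ c = discCost J})
    ⟨_, J, hJ.1, hJ.2, rfl⟩
  exact ⟨K, ⟨h₁, h₂⟩, h₃.symm⟩

/-- A plan between measures charging both last points can be uncrossed so that it moves a unit
of mass between the last points. -/
lemma exists_isDiscPlan_uncross {p q : ℕ} {μ : Fin (p + 1) → ℕ} {ν : Fin (q + 1) → ℕ}
    {J : Fin (p + 1) → Fin (q + 1) → ℕ}
    (hJ : IsDiscPlan (μ + Pi.single (Fin.last p) 1) (ν + Pi.single (Fin.last q) 1) J) :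
    ∃ K, IsDiscPlan μ ν K ∧ discCost K + ((p : ℤ) - (q : ℤ)).natAbs ≤ discCost J := by
  by_cases h0 : 0 < J (Fin.last p) (Fin.last q)
  · obtain ⟨K, rfl⟩ := exists_eq_add_unitPlan h0
    exact ⟨K, (isDiscPlan_add_unitPlan _ _).1 hJ, by simp [discCost_add_unitPlan]⟩
  obtain ⟨j, -, hj⟩ : ∃ j ∈ Finset.univ, J (Fin.last p) j ≠ 0 := by
    apply Finset.exists_ne_zero_of_sum_ne_zero; rw [hJ.1]; simp
  obtain ⟨i, -, hi⟩ : ∃ i ∈ Finset.univ, J i (Fin.last q) ≠ 0 := by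
    apply Finset.exists_ne_zero_of_sum_ne_zero; rw [hJ.2]; simp
  have hi' : i ≠ Fin.last p := by rintro rfl; omega
  obtain ⟨K, rfl⟩ := exists_eq_add_unitPlan (Nat.pos_of_ne_zero hj)
  obtain ⟨K, rfl⟩ : ∃ L, K = L + unitPlan i (Fin.last q) :=
    exists_eq_add_unitPlan (by
      simpa [unitPlan, Pi.single_eq_of_ne hi', Nat.pos_iff_ne_zero] using hi)
  refine ⟨K + unitPlan i j, ?_, ?_⟩
  · simp only [IsDiscPlan, sum_row_add_unitPlan, sum_col_add_unitPlan] at hJ ⊢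
    simp only [Pi.add_apply μ, Pi.add_apply ν] at hJ
    exact ⟨fun k => by have := hJ.1 k; omega, fun l => by have := hJ.2 l; omega⟩
  · simp only [discCost_add_unitPlan, Fin.val_last]
    omega

lemma discEMD_add_single_last {p q : ℕ} {μ : Fin (p + 1) → ℕ} {ν : Fin (q + 1) → ℕ}
    (h : ∑ i, μ i = ∑ j, ν j) :
    discEMD (μ + Pi.single (Fin.last p) 1) (ν + Pi.single (Fin.last q) 1) =
      discEMD μ ν + ((p : ℤ) - (q : ℤ)).natAbs := by
  apply le_antisymm
  · obtain ⟨J, hJ, hc⟩ := exists_discCost_eq_discEMD h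
    rw [← hc]
    simpa [discCost_add_unitPlan] using
      discEMD_le ((isDiscPlan_add_unitPlan (Fin.last p) (Fin.last q)).2 hJ)
  · obtain ⟨J, hJ, hc⟩ := exists_discCost_eq_discEMD
      (μ := μ + Pi.single (Fin.last p) 1) (ν := ν + Pi.single (Fin.last q) 1)
      (by simp [Finset.sum_add_distrib, h])
    obtain ⟨K, hK, hle⟩ := exists_isDiscPlan_uncross hJ
    have := discEMD_le hK
    omega

lemma discEMD_comm {p q : ℕ} (μ : Fin p → ℕ) (ν : Fin q → ℕ) :
    discEMD μ ν = discEMD ν μ := by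
  have key : ∀ {p q : ℕ} (J : Fin p → Fin q → ℕ),
      discCost J = discCost (fun j i => J i j) := by
    intro p q J
    rw [discCost, Finset.sum_comm, discCost]
    refine Finset.sum_congr rfl fun j _ => Finset.sum_congr rfl fun i _ => ?_
    rw [← Int.natAbs_neg, neg_sub]
  unfold discEMD
  congr 1
  ext c
  constructor
  · rintro ⟨J, h₁, h₂, rfl⟩
    exact ⟨fun j i => J i j, h₂, h₁, key J⟩
  · rintro ⟨J, h₁, h₂, rfl⟩
    exact ⟨fun j i => J i j, h₂, h₁, key J⟩

lemma discEMD_snoc_zero_left {p q : ℕ} (μ : Fin p → ℕ) (ν : Fin q → ℕ) :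
    discEMD (Fin.snoc μ 0 : Fin (p + 1) → ℕ) ν = discEMD μ ν := by
  unfold discEMD
  congr 1
  ext c
  constructor
  · rintro ⟨J, h₁, h₂, rfl⟩
    have h0 : ∀ j, J (Fin.last p) j = 0 := by simpa using h₁ (Fin.last p)
    refine ⟨fun i => J i.castSucc, fun i => by simpa using h₁ i.castSucc, fun j => ?_, ?_⟩
    · simpa [Fin.sum_univ_castSucc, h0] using h₂ j
    · simp [discCost, Fin.sum_univ_castSucc, h0]
  · rintro ⟨J, h₁, h₂, rfl⟩
    refine ⟨(Fin.snoc J 0 : Fin (p + 1) → Fin q → ℕ), fun i => ?_, fun j => ?_, ?_⟩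
    · refine Fin.lastCases ?_ (fun i => ?_) i
      · simp
      · simpa using h₁ i
    · simpa [Fin.sum_univ_castSucc] using h₂ j
    · simp [discCost, Fin.sum_univ_castSucc]

lemma discEMD_snoc_zero_right {p q : ℕ} (μ : Fin p → ℕ) (ν : Fin q → ℕ) :
    discEMD μ (Fin.snoc ν 0 : Fin (q + 1) → ℕ) = discEMD μ ν := by
  rw [discEMD_comm, discEMD_snoc_zero_left, discEMD_comm]

/-- Compositions split according to whether their last part vanishes. -/
lemma sum_antidiagonalTuple_succ {M : Type*} [AddCommMonoid M] (p s : ℕ)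
    (f : (Fin (p + 1) → ℕ) → M) :
    ∑ μ ∈ Finset.Nat.antidiagonalTuple (p + 1) (s + 1), f μ =
      ∑ μ ∈ Finset.Nat.antidiagonalTuple p (s + 1), f (Fin.snoc μ 0) +
        ∑ μ ∈ Finset.Nat.antidiagonalTuple (p + 1) s, f (μ + Pi.single (Fin.last p) 1) := by
  rw [← Finset.sum_filter_add_sum_filter_not _ (fun μ => μ (Fin.last p) = 0)]
  congr 1
  · symm
    refine Finset.sum_bij (fun μ _ => (Fin.snoc μ 0 : Fin (p + 1) → ℕ)) ?_ ?_ ?_ ?_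
    · intro μ hμ
      simpa [Finset.Nat.mem_antidiagonalTuple, Fin.sum_univ_castSucc] using hμ
    · intro μ _ ν _ h
      exact (Fin.snoc_inj.1 h).1
    · intro μ hμ
      simp only [Finset.mem_filter, Finset.Nat.mem_antidiagonalTuple,
        Fin.sum_univ_castSucc] at hμ
      refine ⟨Fin.init μ, ?_, ?_⟩
      · simp only [Finset.Nat.mem_antidiagonalTuple, Fin.init]
        omega
      · rw [← hμ.2, Fin.snoc_init_self]
    · intros; rfl
  · symm
    refine Finset.sum_bij (fun μ _ => μ + Pi.single (Fin.last p) 1) ?_ ?_ ?_ ?_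
    · intro μ hμ
      simpa [Finset.Nat.mem_antidiagonalTuple, Finset.sum_add_distrib] using hμ
    · intro μ _ ν _ h
      exact add_right_cancel h
    · intro μ hμ
      simp only [Finset.mem_filter, Finset.Nat.mem_antidiagonalTuple] at hμ
      obtain ⟨μ', rfl⟩ := exists_eq_add_single (Nat.pos_of_ne_zero hμ.2)
      refine ⟨μ', ?_, rfl⟩
      simpa [Finset.Nat.mem_antidiagonalTuple, Finset.sum_add_distrib] using hμ.1
    · intros; rfl

lemma card_antidiagonalTuple_succ (p s : ℕ) :
    (Finset.Nat.antidiagonalTuple (p + 1) s).card = (s + p).choose p := by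
  induction p generalizing s with
  | zero => simp
  | succ p ihp =>
    induction s with
    | zero => simp [Finset.Nat.antidiagonalTuple_zero_right]
    | succ s ihs =>
      have h := sum_antidiagonalTuple_succ (p + 1) s (fun _ => 1)
      simp only [Finset.sum_const, smul_eq_mul, mul_one] at h
      rw [h, ihp, ihs, show s + 1 + (p + 1) = (s + 1 + p) + 1 by ring, Nat.choose_succ_succ,
        show s + (p + 1) = s + 1 + p by ring]

lemma Nsum_zero_left (q s : ℕ) : Nsum 0 q s = 0 := by
  refine Finset.sum_eq_zero fun μ _ => Finset.sum_eq_zero fun ν _ => ?_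
  rw [discEMD, Nat.sInf_eq_zero]
  by_cases h : ∃ J, IsDiscPlan μ ν J
  · obtain ⟨J, hJ⟩ := h
    exact Or.inl ⟨J, hJ.1, hJ.2, by simp [discCost]⟩
  · refine Or.inr (Set.eq_empty_iff_forall_notMem.2 ?_)
    rintro c ⟨J, h₁, h₂, -⟩
    exact h ⟨J, h₁, h₂⟩

lemma Nsum_comm (p q s : ℕ) : Nsum p q s = Nsum q p s := by
  rw [Nsum, Finset.sum_comm]
  simp only [Nsum, discEMD_comm]

/-- Inclusion-exclusion over the vanishing of the two last parts. -/
lemma Nsum_succ_succ (p q s : ℕ) :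
    Nsum (p + 1) (q + 1) (s + 1) + Nsum p q (s + 1) =
      Nsum p (q + 1) (s + 1) + Nsum (p + 1) q (s + 1) + Nsum (p + 1) (q + 1) s +
        ((p : ℤ) - (q : ℤ)).natAbs * ((s + p).choose p * (s + q).choose q) := by
  have h₁ : ∑ μ ∈ Finset.Nat.antidiagonalTuple (p + 1) s,
      ∑ ν ∈ Finset.Nat.antidiagonalTuple (q + 1) s,
        discEMD (μ + Pi.single (Fin.last p) 1) (ν + Pi.single (Fin.last q) 1) =
      Nsum (p + 1) (q + 1) s +
        ((p : ℤ) - (q : ℤ)).natAbs * ((s + p).choose p * (s + q).choose q) := by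
    rw [← card_antidiagonalTuple_succ, ← card_antidiagonalTuple_succ, Nsum]
    have : ∀ μ ∈ Finset.Nat.antidiagonalTuple (p + 1) s,
        ∑ ν ∈ Finset.Nat.antidiagonalTuple (q + 1) s,
          discEMD (μ + Pi.single (Fin.last p) 1) (ν + Pi.single (Fin.last q) 1) =
        ∑ ν ∈ Finset.Nat.antidiagonalTuple (q + 1) s,
          (discEMD μ ν + ((p : ℤ) - (q : ℤ)).natAbs) := fun μ hμ =>
      Finset.sum_congr rfl fun ν hν => discEMD_add_single_last <| by
        rw [Finset.Nat.mem_antidiagonalTuple.1 hμ, Finset.Nat.mem_antidiagonalTuple.1 hν]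
    rw [Finset.sum_congr rfl this]
    simp only [Finset.sum_add_distrib, Finset.sum_const, smul_eq_mul]
    ring
  have h₂ : Nsum p (q + 1) (s + 1) = Nsum p q (s + 1) +
      ∑ μ ∈ Finset.Nat.antidiagonalTuple p (s + 1),
        ∑ ν ∈ Finset.Nat.antidiagonalTuple (q + 1) s,
          discEMD μ (ν + Pi.single (Fin.last q) 1) := by
    simp only [Nsum, sum_antidiagonalTuple_succ, discEMD_snoc_zero_right,
      Finset.sum_add_distrib]
  have h₃ : Nsum (p + 1) q (s + 1) = Nsum p q (s + 1) +
      ∑ μ ∈ Finset.Nat.antidiagonalTuple (p + 1) s,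
        ∑ ν ∈ Finset.Nat.antidiagonalTuple q (s + 1),
          discEMD (μ + Pi.single (Fin.last p) 1) ν := by
    simp only [Nsum, sum_antidiagonalTuple_succ, discEMD_snoc_zero_left]
  rw [h₂, h₃, Nsum]
  simp only [sum_antidiagonalTuple_succ, discEMD_snoc_zero_left, discEMD_snoc_zero_right,
    Finset.sum_add_distrib, h₁]
  simp only [Nsum]
  ring

open Filter Topology Asymptotics

lemma tendsto_natCast_succ_div : Tendsto (fun s : ℕ => ((s : ℝ) + 1) / s) atTop (𝓝 1) := by
  have h : Tendsto (fun s : ℕ => 1 + 1 / (s : ℝ)) atTop (𝓝 (1 + 0)) :=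
    tendsto_const_nhds.add tendsto_one_div_atTop_nhds_zero_nat
  rw [add_zero] at h
  refine h.congr' ?_
  filter_upwards [eventually_ne_atTop 0] with s hs
  field_simp

lemma tendsto_shift_div_pow {u : ℕ → ℝ} {k : ℕ} {L : ℝ}
    (h : Tendsto (fun s => u s / (s : ℝ) ^ k) atTop (𝓝 L)) :
    Tendsto (fun s : ℕ => u (s + 1) / (s : ℝ) ^ k) atTop (𝓝 L) := by
  have h₁ := (h.comp (tendsto_add_atTop_nat 1)).mul (tendsto_natCast_succ_div.pow k)
  rw [one_pow, mul_one] at h₁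
  refine h₁.congr' ?_
  filter_upwards [eventually_ne_atTop 0] with s hs
  simp only [Function.comp_apply, Nat.cast_add, Nat.cast_one, div_pow]
  have : (s : ℝ) + 1 ≠ 0 := by positivity
  field_simp

lemma tendsto_succ_pow_sub_pow_div (k : ℕ) :
    Tendsto (fun s : ℕ => (((s : ℝ) + 1) ^ (k + 1) - (s : ℝ) ^ (k + 1)) / (s : ℝ) ^ k)
      atTop (𝓝 ((k : ℝ) + 1)) := by
  induction k with
  | zero => simp
  | succ k ih =>
    have h := (tendsto_natCast_succ_div.mul ih).add_const 1
    rw [one_mul] at h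
    push_cast
    refine h.congr' ?_
    filter_upwards [eventually_ne_atTop 0] with s hs
    have : (s : ℝ) ≠ 0 := by exact_mod_cast hs
    field_simp
    ring

/-- The Stolz–Cesàro theorem for comparison with a power. -/
lemma tendsto_div_pow_succ_of_sub {f : ℕ → ℝ} {k : ℕ} {L : ℝ}
    (h : Tendsto (fun s => (f (s + 1) - f s) / (s : ℝ) ^ k) atTop (𝓝 L)) :
    Tendsto (fun s => f s / (s : ℝ) ^ (k + 1)) atTop (𝓝 (L / ((k : ℝ) + 1))) := by
  have hk : (k : ℝ) + 1 ≠ 0 := by positivity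
  set c := L / ((k : ℝ) + 1) with hc
  set g : ℕ → ℝ := fun s => ((s : ℝ) + 1) ^ (k + 1) - (s : ℝ) ^ (k + 1) with hg
  have hg_le : ∀ s : ℕ, (s : ℝ) ^ k ≤ g s := by
    intro s
    have : (s : ℝ) ^ k * (s + 1) ≤ ((s : ℝ) + 1) ^ k * (s + 1) := by gcongr; linarith
    simp only [hg, pow_succ]
    linarith
  have hg_sum : ∀ n : ℕ, ∑ i ∈ Finset.range n, g i = (n : ℝ) ^ (k + 1) := by
    intro n
    have := Finset.sum_range_sub (fun i : ℕ => (i : ℝ) ^ (k + 1)) n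
    simpa [hg] using this
  have hlim : Tendsto (fun s : ℕ => ((f (s + 1) - f s) - c * g s) / (s : ℝ) ^ k)
      atTop (𝓝 0) := by
    have := h.sub ((tendsto_succ_pow_sub_pow_div k).const_mul c)
    rw [hc, div_mul_cancel₀ _ hk, sub_self, ← hc] at this
    refine this.congr fun s => ?_
    simp only [hg]
    ring
  have ho : (fun s : ℕ => (f (s + 1) - f s) - c * g s) =o[atTop] g := by
    refine IsLittleO.trans_isBigO (g := fun s : ℕ => (s : ℝ) ^ k) ?_ ?_
    · refine (isLittleO_iff_tendsto' ?_).2 hlim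
      filter_upwards [eventually_ne_atTop 0] with s hs h0
      exact absurd h0 (by positivity)
    · refine IsBigO.of_bound 1 (Eventually.of_forall fun s => ?_)
      have : (0 : ℝ) ≤ (s : ℝ) ^ k := by positivity
      rw [one_mul, Real.norm_of_nonneg this, Real.norm_of_nonneg (this.trans (hg_le s))]
      exact hg_le s
  have hpow : Tendsto (fun n : ℕ => (n : ℝ) ^ (k + 1)) atTop atTop :=
    (tendsto_pow_atTop k.succ_ne_zero).comp tendsto_natCast_atTop_atTop
  have hsum := ho.sum_range
    (fun s => le_trans (by positivity : (0 : ℝ) ≤ (s : ℝ) ^ k) (hg_le s))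
    (by simpa only [hg_sum] using hpow)
  simp only [Finset.sum_sub_distrib, ← Finset.mul_sum, hg_sum] at hsum
  have h₁ := (hsum.tendsto_div_nhds_zero.add (hpow.const_div_atTop (f 0))).add_const c
  rw [zero_add, zero_add] at h₁
  refine h₁.congr' ?_
  filter_upwards [eventually_ne_atTop 0] with n hn
  have hn' : (n : ℝ) ^ (k + 1) ≠ 0 := by positivity
  rw [← Finset.sum_sub_distrib, Finset.sum_range_sub]
  field_simp
  ring

lemma tendsto_add_choose_div_pow (p : ℕ) :
    Tendsto (fun s : ℕ => ((s + p).choose p : ℝ) / (s : ℝ) ^ p) atTop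
      (𝓝 (1 / (p.factorial : ℝ))) := by
  induction p with
  | zero => simp
  | succ p ih =>
    have h := tendsto_div_pow_succ_of_sub
      (f := fun s : ℕ => ((s + (p + 1)).choose (p + 1) : ℝ)) (k := p)
      (L := 1 / (p.factorial : ℝ)) ?_
    · convert h using 2
      rw [Nat.factorial_succ]
      push_cast
      field_simp
    · refine (tendsto_shift_div_pow ih).congr fun s => ?_
      rw [show s + 1 + (p + 1) = (s + 1 + p) + 1 by ring, Nat.choose_succ_succ,
        show s + (p + 1) = s + 1 + p by ring]
      push_cast
      ring

lemma Mrec_succ_succ_s1 (p q : ℕ) : Mrec (p + 1) (q + 1) =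
    ((p : ℝ) * Mrec p (q + 1) + (q : ℝ) * Mrec (p + 1) q + |(p : ℝ) - (q : ℝ)|)
      / ((p : ℝ) + (q : ℝ) + 1) := by
  rw [Mrec]

/-- The leading-order growth of `Nsum`, in a form that also covers `p = 0` and `q = 0`. -/
lemma tendsto_Nsum_mul_div_pow (p q : ℕ) :
    Tendsto (fun s : ℕ => (Nsum p q s : ℝ) * s / (s : ℝ) ^ (p + q)) atTop
      (𝓝 (p * q * Mrec p q / (p.factorial * q.factorial))) := by
  induction p generalizing q with
  | zero => simp [Nsum_zero_left]
  | succ p ihp =>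
    induction q with
    | zero => simp [Nsum_comm _ 0, Nsum_zero_left]
    | succ q ihq =>
      have h₁ : Tendsto (fun s : ℕ => (Nsum p (q + 1) s : ℝ) / (s : ℝ) ^ (p + q)) atTop
          (𝓝 (p * (q + 1) * Mrec p (q + 1) / (p.factorial * (q + 1).factorial))) := by
        have := ihp (q + 1)
        push_cast at this
        refine this.congr' ?_
        filter_upwards [eventually_ne_atTop 0] with s hs
        rw [← add_assoc, pow_succ, mul_div_mul_right _ _ (by positivity)]
      have h₂ : Tendsto (fun s : ℕ => (Nsum (p + 1) q s : ℝ) / (s : ℝ) ^ (p + q)) atTop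
          (𝓝 ((p + 1) * q * Mrec (p + 1) q / ((p + 1).factorial * q.factorial))) := by
        push_cast at ihq
        refine ihq.congr' ?_
        filter_upwards [eventually_ne_atTop 0] with s hs
        rw [add_right_comm, pow_succ, mul_div_mul_right _ _ (by positivity)]
      have h₃ : Tendsto (fun s : ℕ => (Nsum p q s : ℝ) / (s : ℝ) ^ (p + q)) atTop (𝓝 0) := by
        have := (ihp q).mul tendsto_one_div_atTop_nhds_zero_nat
        rw [mul_zero] at this
        refine this.congr' ?_
        filter_upwards [eventually_ne_atTop 0] with s hs
        field_simp
      have h₄ := ((tendsto_add_choose_div_pow p).mul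
        (tendsto_add_choose_div_pow q)).const_mul |(p : ℝ) - q|
      have hmain := tendsto_div_pow_succ_of_sub (f := fun s => (Nsum (p + 1) (q + 1) s : ℝ))
        (k := p + q) ((((tendsto_shift_div_pow h₁).add (tendsto_shift_div_pow h₂)).sub
          (tendsto_shift_div_pow h₃)).add h₄ |>.congr fun s => by
            have h := congrArg (Nat.cast : ℕ → ℝ) (Nsum_succ_succ p q s)
            push_cast [Nat.cast_natAbs] at h
            have h' : (Nsum (p + 1) (q + 1) (s + 1) : ℝ) - Nsum (p + 1) (q + 1) s =
                Nsum p (q + 1) (s + 1) + Nsum (p + 1) q (s + 1) - Nsum p q (s + 1) +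
                  |(p : ℝ) - q| * ((s + p).choose p * (s + q).choose q) := by
              linarith
            rw [h', pow_add]
            ring)
      have hev : (fun s : ℕ => (Nsum (p + 1) (q + 1) s : ℝ) / (s : ℝ) ^ (p + q + 1)) =ᶠ[atTop]
          fun s : ℕ => (Nsum (p + 1) (q + 1) s : ℝ) * s / (s : ℝ) ^ (p + 1 + (q + 1)) := by
        filter_upwards [eventually_ne_atTop 0] with s hs
        rw [show p + 1 + (q + 1) = p + q + 1 + 1 by ring, pow_succ _ (p + q + 1),
          mul_div_mul_right _ _ (by positivity)]
      convert hmain.congr' hev using 2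
      rw [Mrec_succ_succ_s1, Nat.factorial_succ, Nat.factorial_succ]
      push_cast
      field_simp
      ring

/-- The expected value of the normalized discrete EMD over uniformly random pairs of
compositions of `s` converges to `M(p,q)` as `s → ∞`. -/
theorem expected_discEMD_tendsto (p q : ℕ) (hp : 1 ≤ p) (hq : 1 ≤ q) :
    Filter.Tendsto
      (fun s : ℕ => (Nsum p q s : ℝ) /
        ((s : ℝ) * (Nat.choose (s + p - 1) (p - 1) : ℝ) * (Nat.choose (s + q - 1) (q - 1) : ℝ)))
      Filter.atTop (nhds (Mrec p q)) := by
  obtain ⟨p, rfl⟩ := Nat.exists_eq_add_of_le' hp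
  obtain ⟨q, rfl⟩ := Nat.exists_eq_add_of_le' hq
  have h := (tendsto_Nsum_mul_div_pow (p + 1) (q + 1)).div
    ((tendsto_add_choose_div_pow p).mul (tendsto_add_choose_div_pow q)) (by positivity)
  have hlim : ((p + 1 : ℕ) : ℝ) * (q + 1 : ℕ) * Mrec (p + 1) (q + 1) /
      ((p + 1).factorial * (q + 1).factorial) / (1 / p.factorial * (1 / q.factorial)) =
      Mrec (p + 1) (q + 1) := by
    rw [Nat.factorial_succ, Nat.factorial_succ]
    push_cast
    field_simp
  rw [hlim] at h
  refine h.congr' ?_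
  filter_upwards [eventually_ne_atTop 0] with s hs
  have hp' : ((s + p).choose p : ℝ) ≠ 0 := by
    exact_mod_cast (Nat.choose_pos (Nat.le_add_left p s)).ne'
  have hq' : ((s + q).choose q : ℝ) ≠ 0 := by
    exact_mod_cast (Nat.choose_pos (Nat.le_add_left q s)).ne'
  simp only [← add_assoc, Nat.add_sub_cancel, Pi.div_apply]
  field_simp
  ring
end

section
/- For all s ∈ ℕ, all integers p, q ≥ 1, all μ ∈ C(s,p) and ν ∈ C(s,q), the discrete Earth Mover's Distance satisfies EMD(μ,ν) = Σ_{k=0}^{m-1} |Σ_{i=0}^{k} (μ̃ i - ν̃ i)|, where m = max(p,q) and μ̃, ν̃ : Fin m → ℤ are the extensions of μ and ν by zeros. -/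
/-- The mass that `μ` puts on the indices below `k`. -/
def massBelow {p : ℕ} (μ : Fin p → ℕ) (k : ℕ) : ℕ :=
  ∑ i : Fin p, if (i : ℕ) < k then μ i else 0

lemma massBelow_zero {p : ℕ} (μ : Fin p → ℕ) : massBelow μ 0 = 0 := by
  simp [massBelow]

lemma massBelow_le_sum {p : ℕ} (μ : Fin p → ℕ) (k : ℕ) : massBelow μ k ≤ ∑ i, μ i :=
  Finset.sum_le_sum fun i _ => by split_ifs <;> simp

lemma massBelow_self {p : ℕ} (μ : Fin p → ℕ) : massBelow μ p = ∑ i, μ i := by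
  simp [massBelow]

lemma massBelow_mono {p : ℕ} (μ : Fin p → ℕ) : Monotone (massBelow μ) := by
  intro k l hkl
  refine Finset.sum_le_sum fun i _ => ?_
  split_ifs <;> omega

lemma massBelow_succ {p : ℕ} (μ : Fin p → ℕ) (i : Fin p) :
    massBelow μ (i + 1) = massBelow μ i + μ i := by
  have h : μ i = ∑ j : Fin p, if j = i then μ j else 0 := by simp
  rw [h, massBelow, massBelow, ← Finset.sum_add_distrib]
  refine Finset.sum_congr rfl fun j _ => ?_
  have hj : j = i ↔ (j : ℕ) = i := Fin.ext_iff
  split_ifs <;> omega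

lemma sum_Iic_extend_eq_massBelow {p m : ℕ} (hpm : p ≤ m) (μ : Fin p → ℕ) (k : Fin m) :
    ∑ i ∈ Finset.Iic k, (if h : (i : ℕ) < p then (μ ⟨i, h⟩ : ℤ) else 0) =
      massBelow μ (k + 1) := by
  let a : ℕ → ℤ := fun i =>
    if i < (k : ℕ) + 1 then (if h : i < p then (μ ⟨i, h⟩ : ℤ) else 0) else 0
  have hleft : ∑ i ∈ Finset.Iic k, (if h : (i : ℕ) < p then (μ ⟨i, h⟩ : ℤ) else 0) =
      ∑ i : Fin m, a i := by
    have hIic : Finset.Iic k = Finset.univ.filter fun i : Fin m => (i : ℕ) < (k : ℕ) + 1 := by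
      ext i
      rw [Finset.mem_Iic, Finset.mem_filter_univ, Fin.le_def, Nat.lt_succ_iff]
    rw [hIic, Finset.sum_filter]
  have hright : (massBelow μ (k + 1) : ℤ) = ∑ i : Fin p, a i := by
    simp [massBelow, a]
  rw [hleft, hright, Fin.sum_univ_eq_sum_range a, Fin.sum_univ_eq_sum_range a]
  symm
  refine Finset.sum_subset (Finset.range_mono hpm) fun i _ hi => ?_
  have : ¬ i < p := by simpa using hi
  simp [a, this]

/-- The quantile function of `μ`. -/
lemma exists_quantile {p s : ℕ} (μ : Fin p → ℕ) (hμ : ∑ i, μ i = s) :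
    ∃ f : Fin s → Fin p, ∀ t k, (f t : ℕ) < k ↔ (t : ℕ) < massBelow μ k := by
  have key : ∀ t : Fin s, ∃ i : Fin p, ∀ k, (i : ℕ) < k ↔ (t : ℕ) < massBelow μ k := by
    intro t
    have hex : ∃ k, (t : ℕ) < massBelow μ k := ⟨p, by rw [massBelow_self, hμ]; exact t.2⟩
    have hle : Nat.find hex ≤ p := Nat.find_min' hex (by rw [massBelow_self, hμ]; exact t.2)
    have hpos : Nat.find hex ≠ 0 := by
      intro h0
      have := Nat.find_spec hex
      rw [h0, massBelow_zero] at this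
      omega
    refine ⟨⟨Nat.find hex - 1, by omega⟩, fun k => ⟨fun hk => ?_, fun hk => ?_⟩⟩
    · exact (Nat.find_spec hex).trans_le (massBelow_mono μ (by simp only at hk; omega))
    · have := Nat.find_min' hex hk
      simp only
      omega
  choose f hf using key
  exact ⟨f, hf⟩

lemma card_quantile_fiber {p s : ℕ} (μ : Fin p → ℕ) (hμ : ∑ i, μ i = s) {f : Fin s → Fin p}
    (hf : ∀ t k, (f t : ℕ) < k ↔ (t : ℕ) < massBelow μ k) (i : Fin p) :
    (∑ t, if f t = i then 1 else 0) = μ i := by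
  have hfib : ∀ t : Fin s, f t = i ↔ (t : ℕ) ∈ Finset.Ico (massBelow μ i) (massBelow μ (i + 1)) := by
    intro t
    rw [Finset.mem_Ico, ← hf t (i + 1), ← not_lt, ← hf t i, Fin.ext_iff]
    omega
  simp only [hfib]
  rw [Fin.sum_univ_eq_sum_range (fun t : ℕ =>
    if t ∈ Finset.Ico (massBelow μ i) (massBelow μ (i + 1)) then 1 else 0), ← Finset.sum_filter,
    Finset.filter_mem_eq_inter, Finset.inter_eq_right.mpr, Finset.sum_const, Nat.card_Ico,
    massBelow_succ]
  · simp
  · intro t ht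
    have := massBelow_le_sum μ (i + 1)
    simp only [Finset.mem_Ico, Finset.mem_range] at ht ⊢
    omega

lemma sum_abs_indicator_sub {m x y : ℕ} (hx : x ≤ m) (hy : y ≤ m) :
    ∑ k ∈ Finset.range m, |(if k < x then (1 : ℤ) else 0) - (if k < y then 1 else 0)| =
      |(x : ℤ) - y| := by
  have key : ∀ n : ℕ,
      ∑ k ∈ Finset.range n, |(if k < x then (1 : ℤ) else 0) - (if k < y then 1 else 0)| =
        |((min x n : ℕ) : ℤ) - (min y n : ℕ)| := by
    intro n
    induction n with
    | zero => simp
    | succ n ih =>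
      rw [Finset.sum_range_succ, ih]
      have hstep : ∀ z : ℕ, ((min z (n + 1) : ℕ) : ℤ) = (min z n : ℕ) + if n < z then 1 else 0 := by
        intro z
        split_ifs <;> omega
      rw [hstep x, hstep y]
      simp only [Int.abs_eq_natAbs]
      split_ifs <;> omega
  rw [key, min_eq_left hx, min_eq_left hy]

lemma abs_sub_eq_sum_thresholds {m i j : ℕ} (hi : i ≤ m) (hj : j ≤ m) :
    |(i : ℤ) - j| =
      ∑ k : Fin m, |(if i < (k : ℕ) + 1 then (1 : ℤ) else 0) - (if j < (k : ℕ) + 1 then 1 else 0)| := by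
  rw [Fin.sum_univ_eq_sum_range (fun k : ℕ =>
    |(if i < k + 1 then (1 : ℤ) else 0) - (if j < k + 1 then 1 else 0)|),
    ← sum_abs_indicator_sub hi hj]
  refine Finset.sum_congr rfl fun k _ => ?_
  split_ifs <;> first | omega | simp

/-- Every transport plan costs at least the sum of the mass imbalances over all thresholds. -/
lemma sum_abs_massBelow_le_discCost {p q : ℕ} (μ : Fin p → ℕ) (ν : Fin q → ℕ)
    (J : Fin p → Fin q → ℕ) (hrow : ∀ i, ∑ j, J i j = μ i) (hcol : ∀ j, ∑ i, J i j = ν j) :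
    ∑ k : Fin (max p q), |(massBelow μ (k + 1) : ℤ) - massBelow ν (k + 1)| ≤ discCost J := by
  have hcost : (discCost J : ℤ) = ∑ k : Fin (max p q), ∑ i : Fin p, ∑ j : Fin q,
      |((if (i : ℕ) < (k : ℕ) + 1 then (1 : ℤ) else 0) -
        (if (j : ℕ) < (k : ℕ) + 1 then 1 else 0)) * J i j| := by
    rw [discCost, Finset.sum_comm (s := (Finset.univ : Finset (Fin (max p q))))]
    push_cast
    refine Finset.sum_congr rfl fun i _ => ?_
    rw [Finset.sum_comm (s := (Finset.univ : Finset (Fin (max p q))))]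
    refine Finset.sum_congr rfl fun j _ => ?_
    rw [abs_sub_eq_sum_thresholds (m := max p q) (by omega) (by omega), Finset.sum_mul]
    refine Finset.sum_congr rfl fun k _ => ?_
    rw [abs_mul, Nat.abs_cast]
  rw [hcost]
  refine Finset.sum_le_sum fun k _ => ?_
  have hdiff : (massBelow μ (k + 1) : ℤ) - massBelow ν (k + 1) = ∑ i : Fin p, ∑ j : Fin q,
      ((if (i : ℕ) < (k : ℕ) + 1 then (1 : ℤ) else 0) -
        (if (j : ℕ) < (k : ℕ) + 1 then 1 else 0)) * J i j := by
    simp only [sub_mul, Finset.sum_sub_distrib]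
    congr 1
    · rw [massBelow]
      push_cast
      refine Finset.sum_congr rfl fun i _ => ?_
      rw [← Finset.mul_sum, ← hrow i]
      simp
    · rw [massBelow, Finset.sum_comm]
      push_cast
      refine Finset.sum_congr rfl fun j _ => ?_
      rw [← Finset.mul_sum, ← hcol j]
      simp
  rw [hdiff]
  exact (Finset.abs_sum_le_sum_abs _ _).trans
    (Finset.sum_le_sum fun i _ => Finset.abs_sum_le_sum_abs _ _)

/-- The quantile coupling attains the sum of the mass imbalances over all thresholds. -/
lemma exists_plan_discCost_eq {s p q : ℕ} (μ : Fin p → ℕ) (ν : Fin q → ℕ)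
    (hμ : ∑ i, μ i = s) (hν : ∑ j, ν j = s) :
    ∃ J : Fin p → Fin q → ℕ, (∀ i, ∑ j, J i j = μ i) ∧ (∀ j, ∑ i, J i j = ν j) ∧
      (discCost J : ℤ) =
        ∑ k : Fin (max p q), |(massBelow μ (k + 1) : ℤ) - massBelow ν (k + 1)| := by
  obtain ⟨f, hf⟩ := exists_quantile μ hμ
  obtain ⟨g, hg⟩ := exists_quantile ν hν
  refine ⟨fun i j => ∑ t, if f t = i then (if g t = j then 1 else 0) else 0,
    fun i => ?_, fun j => ?_, ?_⟩
  · rw [Finset.sum_comm, ← card_quantile_fiber μ hμ hf i]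
    refine Finset.sum_congr rfl fun t _ => ?_
    split_ifs <;> simp
  · rw [Finset.sum_comm, ← card_quantile_fiber ν hν hg j]
    refine Finset.sum_congr rfl fun t _ => ?_
    simp
  · have hcost : (discCost fun i j => ∑ t, if f t = i then (if g t = j then 1 else 0) else 0) =
        ∑ t, ((f t : ℤ) - (g t : ℤ)).natAbs := by
      simp only [discCost, Finset.mul_sum]
      simp_rw [Finset.sum_comm (s := (Finset.univ : Finset (Fin q)))]
      rw [Finset.sum_comm]
      refine Finset.sum_congr rfl fun t _ => ?_
      rw [Finset.sum_eq_single (f t), Finset.sum_eq_single (g t)]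
      · simp
      · intro j _ hj
        simp [hj.symm]
      · simp
      · intro i _ hi
        simp [hi.symm]
      · simp
    rw [hcost]
    push_cast
    simp_rw [fun t => abs_sub_eq_sum_thresholds (m := max p q) (i := f t) (j := g t)
      (by omega) (by omega)]
    rw [Finset.sum_comm]
    refine Finset.sum_congr rfl fun k _ => ?_
    simp only [hf, hg]
    rw [Fin.sum_univ_eq_sum_range (fun t : ℕ =>
      |(if t < massBelow μ (k + 1) then (1 : ℤ) else 0) -
        (if t < massBelow ν (k + 1) then 1 else 0)|)]
    exact sum_abs_indicator_sub (hμ ▸ massBelow_le_sum μ _) (hν ▸ massBelow_le_sum ν _)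

/-- The discrete EMD of two compositions of `s` equals the sum of the absolute values of
the partial sums of the difference of their extensions by zeros to `max p q` parts. -/
theorem discEMD_eq_partial_sums (s p q : ℕ) (hp : 1 ≤ p) (hq : 1 ≤ q)
    (μ : Fin p → ℕ) (ν : Fin q → ℕ) (hμ : ∑ i, μ i = s) (hν : ∑ j, ν j = s) :
    (discEMD μ ν : ℤ) =
      ∑ k : Fin (max p q), |∑ i ∈ Finset.Iic k,
        ((if h : (i : ℕ) < p then (μ ⟨i, h⟩ : ℤ) else 0) -
         (if h : (i : ℕ) < q then (ν ⟨i, h⟩ : ℤ) else 0))| := by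
  simp only [Finset.sum_sub_distrib, sum_Iic_extend_eq_massBelow (le_max_left p q) μ,
    sum_Iic_extend_eq_massBelow (le_max_right p q) ν]
  obtain ⟨J, hrow, hcol, hJ⟩ := exists_plan_discCost_eq μ ν hμ hν
  apply le_antisymm
  · rw [← hJ]
    have hle : discEMD μ ν ≤ discCost J := Nat.sInf_le ⟨J, hrow, hcol, rfl⟩
    exact_mod_cast hle
  · obtain ⟨K, hKrow, hKcol, hK⟩ := Nat.sInf_mem
      (s := {c | ∃ J : Fin p → Fin q → ℕ,
        (∀ i, ∑ j, J i j = μ i) ∧ (∀ j, ∑ i, J i j = ν j) ∧ c = discCost J})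
      ⟨_, J, hrow, hcol, rfl⟩
    rw [discEMD, hK]
    exact sum_abs_massBelow_le_discCost μ ν K hKrow hKcol
end

section
/- Let p, q ≥ 1, s ∈ ℕ, μ ∈ C(s,p), ν ∈ C(s,q), and let J : Fin p → Fin q → ℕ be a matrix with row sums Σ_j J i j = μ i for all i and column sums Σ_i J i j = ν j for all j. Then there exists a matrix J' : Fin p → Fin q → ℕ with the same row sums μ and column sums ν, whose support is a chain in Fin p × Fin q under the componentwise partial order, and such that Σ_{i,j} |i - j| · J' i j ≤ Σ_{i,j} |i - j| · J i j. -/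
/-- Moving one unit of mass from the cells `(i, j')`, `(i', j)` to the cells `(i, j)`, `(i', j')`
changes every weighted total by the corresponding four weights. -/
theorem exists_swap_weighted_sum {α β : Type*} [Fintype α] [Fintype β]
    (J : α → β → ℕ) {i i' : α} {j j' : β} (hi : i ≠ i')
    (h₁ : J i j' ≠ 0) (h₂ : J i' j ≠ 0) :
    ∃ J' : α → β → ℕ, ∀ w : α → β → ℕ,
      (∑ x, ∑ y, w x y * J' x y) + w i j' + w i' j =
        (∑ x, ∑ y, w x y * J x y) + w i j + w i' j' := by
  classical
  let unit : α → β → α → β → ℕ := fun a b x y => if x = a then (if y = b then 1 else 0) else 0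
  have sum_unit (w : α → β → ℕ) (a : α) (b : β) : ∑ x, ∑ y, w x y * unit a b x y = w a b := by
    simp only [unit, mul_ite, mul_one, mul_zero]
    rw [Finset.sum_eq_single a (by intros; simp_all) (by simp)]
    simp
  refine ⟨fun x y => J x y + unit i j x y + unit i' j' x y - unit i j' x y - unit i' j x y,
    fun w => ?_⟩
  rw [← sum_unit w i j', ← sum_unit w i' j, ← sum_unit w i j, ← sum_unit w i' j']
  simp only [← Finset.sum_add_distrib, ← mul_add]
  refine Finset.sum_congr rfl fun x _ => Finset.sum_congr rfl fun y _ => congrArg _ ?_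
  have hle : unit i j' x y + unit i' j x y ≤ J x y := by
    simp only [unit]
    split_ifs <;> first | omega | (subst_vars; first | omega | exact absurd rfl hi)
  omega

/-- The cost `|i - j|` does not increase when two crossing pairs are uncrossed. -/
theorem natAbs_sub_uncross_le {a a' b b' : ℕ} (ha : a < a') (hb : b < b') :
    ((a : ℤ) - b).natAbs + ((a' : ℤ) - b').natAbs ≤
      ((a : ℤ) - b').natAbs + ((a' : ℤ) - b).natAbs := by
  omega

/-- The cost `(i - j) ^ 2` strictly decreases when two crossing pairs are uncrossed. -/
theorem natAbs_sub_sq_uncross_lt {a a' b b' : ℕ} (ha : a < a') (hb : b < b') :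
    ((a : ℤ) - b).natAbs ^ 2 + ((a' : ℤ) - b').natAbs ^ 2 <
      ((a : ℤ) - b').natAbs ^ 2 + ((a' : ℤ) - b).natAbs ^ 2 := by
  zify at ha hb ⊢
  simp only [sq_abs]
  nlinarith [mul_pos (sub_pos.2 ha) (sub_pos.2 hb)]

/-- If the support of a matrix is not a chain, then it contains two crossing cells. -/
theorem exists_crossing_of_not_isChain {p q : ℕ} {J : Fin p → Fin q → ℕ}
    (h : ¬ IsChain (· ≤ ·) {x : Fin p × Fin q | J x.1 x.2 ≠ 0}) :
    ∃ i i' j j', i < i' ∧ j < j' ∧ J i j' ≠ 0 ∧ J i' j ≠ 0 := by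
  contrapose! h
  rintro ⟨a, b⟩ hab ⟨c, d⟩ hcd -
  by_contra! hn
  simp only [Prod.mk_le_mk, not_and_or, not_le] at hn
  simp only [Set.mem_ofPred_eq] at hab hcd
  obtain ⟨hac | hbd, hca | hdb⟩ := hn
  · exact absurd hac hca.asymm
  · exact hab (h c a b d hac hdb hcd)
  · exact hcd (h a c d b hca hbd hab)
  · exact absurd hbd hdb.asymm

/-- A matrix with prescribed row and column sums can be replaced by one whose support is a
chain (in the componentwise order) without increasing the transport cost. -/
theorem exists_chain_support_le_cost (s p q : ℕ) (hp : 1 ≤ p) (hq : 1 ≤ q)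
    (μ : Fin p → ℕ) (ν : Fin q → ℕ) (hμ : ∑ i, μ i = s) (hν : ∑ j, ν j = s)
    (J : Fin p → Fin q → ℕ)
    (hrow : ∀ i, ∑ j, J i j = μ i) (hcol : ∀ j, ∑ i, J i j = ν j) :
    ∃ J' : Fin p → Fin q → ℕ,
      (∀ i, ∑ j, J' i j = μ i) ∧ (∀ j, ∑ i, J' i j = ν j) ∧
      IsChain (· ≤ ·) {x : Fin p × Fin q | J' x.1 x.2 ≠ 0} ∧
      (∑ i : Fin p, ∑ j : Fin q, ((i : ℤ) - (j : ℤ)).natAbs * J' i j) ≤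
        (∑ i : Fin p, ∑ j : Fin q, ((i : ℤ) - (j : ℤ)).natAbs * J i j) := by
  induction hn : ∑ i : Fin p, ∑ j : Fin q, ((i : ℤ) - (j : ℤ)).natAbs ^ 2 * J i j
    using Nat.strong_induction_on generalizing J with
  | _ n ih =>
    by_cases hchain : IsChain (· ≤ ·) {x : Fin p × Fin q | J x.1 x.2 ≠ 0}
    · exact ⟨J, hrow, hcol, hchain, le_rfl⟩
    obtain ⟨i, i', j, j', hi, hj, h₁, h₂⟩ := exists_crossing_of_not_isChain hchain
    obtain ⟨K, hK⟩ := exists_swap_weighted_sum J hi.ne h₁ h₂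
    have hKrow (x : Fin p) : ∑ y, K x y = μ x := by
      have := hK fun a _ => if a = x then 1 else 0
      simp only [ite_mul, one_mul, zero_mul, Finset.sum_ite_irrel, Finset.sum_const_zero,
        Finset.sum_ite_eq', Finset.mem_univ, if_true, hrow] at this
      omega
    have hKcol (y : Fin q) : ∑ x, K x y = ν y := by
      have := hK fun _ b => if b = y then 1 else 0
      simp only [ite_mul, one_mul, zero_mul, Finset.sum_ite_eq', Finset.mem_univ, if_true,
        hcol] at this
      omega
    have hsq := hK fun a b => ((a : ℤ) - (b : ℤ)).natAbs ^ 2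
    have habs := hK fun a b => ((a : ℤ) - (b : ℤ)).natAbs
    have hlt := natAbs_sub_sq_uncross_lt (Fin.lt_def.1 hi) (Fin.lt_def.1 hj)
    have hle := natAbs_sub_uncross_le (Fin.lt_def.1 hi) (Fin.lt_def.1 hj)
    obtain ⟨J', hr, hc, hch, hcost⟩ := ih _ (by linarith) K hKrow hKcol rfl
    exact ⟨J', hr, hc, hch, by linarith⟩
end

section
/- For all s ∈ ℕ and integers p, q ≥ 1, the map sending a matrix J to the pair (row sums of J, column sums of J) is a bijection from R(p,q;s) = {J : Fin p → Fin q → ℕ | Σ_{i,j} J i j = s and the support of J is a chain in Fin p × Fin q} onto C(s,p) × C(s,q). -/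
open Finset

/-- A matrix with chain support has, over any rectangle of lower sets, a sum that is
determined by its row sums and column sums. -/
theorem sum_rectangle_eq_min {α β : Type*} [LinearOrder α] [Fintype α] [LinearOrder β]
    [Fintype β] {J : α → β → ℕ} (hJ : IsChain (· ≤ ·) {x : α × β | J x.1 x.2 ≠ 0})
    {L : Finset α} {M : Finset β} (hL : IsLowerSet (L : Set α)) (hM : IsLowerSet (M : Set β)) :
    ∑ i ∈ L, ∑ j ∈ M, J i j = min (∑ i ∈ L, ∑ j, J i j) (∑ j ∈ M, ∑ i, J i j) := by
  have hrow : ∑ i ∈ L, ∑ j ∈ M, J i j ≤ ∑ i ∈ L, ∑ j, J i j :=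
    sum_le_sum fun i _ => sum_le_sum_of_subset (subset_univ M)
  have hcol : ∑ i ∈ L, ∑ j ∈ M, J i j ≤ ∑ j ∈ M, ∑ i, J i j := by
    rw [sum_comm]
    exact sum_le_sum fun j _ => sum_le_sum_of_subset (subset_univ L)
  by_cases h : ∀ i ∈ L, ∀ j ∉ M, J i j = 0
  · have heq : ∑ i ∈ L, ∑ j ∈ M, J i j = ∑ i ∈ L, ∑ j, J i j :=
      sum_congr rfl fun i hi => sum_subset (subset_univ M) fun j _ hj => h i hi j hj
    omega
  · push Not at h
    obtain ⟨i, hi, j, hj, hij⟩ := h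
    have hzero : ∀ i' ∉ L, ∀ j' ∈ M, J i' j' = 0 := by
      intro i' hi' j' hj'
      by_contra hne
      rcases hJ.total (x := (i, j)) (y := (i', j')) hij hne with hle | hle
      · exact hj (hM hle.2 hj')
      · exact hi' (hL hle.1 hi)
    have heq : ∑ i ∈ L, ∑ j ∈ M, J i j = ∑ j ∈ M, ∑ i, J i j := by
      rw [sum_comm]
      exact sum_congr rfl fun j' hj' =>
        sum_subset (subset_univ L) fun i' _ hi' => hzero i' hi' j' hj'
    omega

/-- An entry of a matrix is an alternating sum of the four adjacent rectangle sums. -/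
theorem sum_Iic_Iic_add_sum_Iio_Iio {α β : Type*} [LinearOrder α] [LocallyFiniteOrderBot α]
    [LinearOrder β] [LocallyFiniteOrderBot β] (J : α → β → ℕ) (a : α) (b : β) :
    ∑ i ∈ Iic a, ∑ j ∈ Iic b, J i j + ∑ i ∈ Iio a, ∑ j ∈ Iio b, J i j =
      J a b + ∑ i ∈ Iio a, ∑ j ∈ Iic b, J i j + ∑ i ∈ Iic a, ∑ j ∈ Iio b, J i j := by
  simp only [← Iio_insert, sum_insert notMem_Iio_self, sum_add_distrib]
  ring

/-- A matrix with chain support is determined by its row sums and column sums. -/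
theorem eq_of_rowSums_eq_of_colSums_eq {α β : Type*} [LinearOrder α] [Fintype α]
    [LocallyFiniteOrderBot α] [LinearOrder β] [Fintype β] [LocallyFiniteOrderBot β]
    {J K : α → β → ℕ} (hJ : IsChain (· ≤ ·) {x : α × β | J x.1 x.2 ≠ 0})
    (hK : IsChain (· ≤ ·) {x : α × β | K x.1 x.2 ≠ 0})
    (hrow : ∀ i, ∑ j, J i j = ∑ j, K i j) (hcol : ∀ j, ∑ i, J i j = ∑ i, K i j) : J = K := by
  have hrect : ∀ {L : Finset α} {M : Finset β}, IsLowerSet (L : Set α) →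
      IsLowerSet (M : Set β) → ∑ i ∈ L, ∑ j ∈ M, J i j = ∑ i ∈ L, ∑ j ∈ M, K i j := by
    intro L M hL hM
    simp only [sum_rectangle_eq_min hJ hL hM, sum_rectangle_eq_min hK hL hM, hrow, hcol]
  funext a b
  have hJab := sum_Iic_Iic_add_sum_Iio_Iio J a b
  have hKab := sum_Iic_Iic_add_sum_Iio_Iio K a b
  have ha : IsLowerSet (Iic a : Set α) := by simpa using isLowerSet_Iic a
  have ha' : IsLowerSet (Iio a : Set α) := by simpa using isLowerSet_Iio a
  have hb : IsLowerSet (Iic b : Set β) := by simpa using isLowerSet_Iic b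
  have hb' : IsLowerSet (Iio b : Set β) := by simpa using isLowerSet_Iio b
  rw [hrect ha hb, hrect ha' hb', hrect ha' hb, hrect ha hb'] at hJab
  omega

/-- Every composition of `s` is the sequence of fiber sizes of a monotone map on `Fin s`. -/
theorem exists_monotone_card_fiber_eq {α : Type*} [LinearOrder α] [Fintype α] {s : ℕ}
    (a : α → ℕ) (ha : ∑ i, a i = s) :
    ∃ f : Fin s → α, Monotone f ∧ ∀ i, #{k | f k = i} = a i := by
  let : Fintype (Σₗ i, Fin (a i)) := inferInstanceAs (Fintype (Σ i, Fin (a i)))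
  have hcard : Fintype.card (Σₗ i, Fin (a i)) = s := by
    rw [← ha]
    exact (Fintype.card_sigma (α := fun i => Fin (a i))).trans (by simp)
  let e : Fin s ≃o Σₗ i, Fin (a i) := Fintype.orderIsoFinOfCardEq _ hcard
  refine ⟨fun k => (e k).1, fun k l hkl => ?_, fun i => ?_⟩
  · rcases Sigma.Lex.le_def.1 (e.monotone hkl) with h | ⟨h, _⟩
    · exact h.le
    · exact h.le
  · rw [← Fintype.card_subtype]
    refine (Fintype.card_congr ((e.toEquiv.subtypeEquiv fun _ => Iff.rfl).trans
      (Equiv.sigmaSubtype i))).trans (Fintype.card_fin _)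

/-- The map sending a matrix to its pair (row sums, column sums) is a bijection from the
set of matrices with total sum `s` and chain support onto `C(s,p) × C(s,q)`. -/
theorem rowColSums_bijOn (s p q : ℕ) (hp : 1 ≤ p) (hq : 1 ≤ q) :
    Set.BijOn
      (fun J : Fin p → Fin q → ℕ => ((fun i => ∑ j, J i j), (fun j => ∑ i, J i j)))
      {J : Fin p → Fin q → ℕ | (∑ i : Fin p, ∑ j : Fin q, J i j) = s ∧
        IsChain (· ≤ ·) {x : Fin p × Fin q | J x.1 x.2 ≠ 0}}
      {x : (Fin p → ℕ) × (Fin q → ℕ) | (∑ i, x.1 i = s) ∧ (∑ j, x.2 j = s)} := by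
  refine ⟨fun J hJ => ⟨hJ.1, sum_comm.trans hJ.1⟩, fun J hJ K hK hJK => ?_, ?_⟩
  · rw [Prod.mk.injEq] at hJK
    exact eq_of_rowSums_eq_of_colSums_eq hJ.2 hK.2 (congrFun hJK.1) (congrFun hJK.2)
  · rintro ⟨a, b⟩ ⟨ha, hb⟩
    obtain ⟨f, hf, hfa⟩ := exists_monotone_card_fiber_eq a ha
    obtain ⟨g, hg, hgb⟩ := exists_monotone_card_fiber_eq b hb
    have hrow (i : Fin p) : ∑ j, #{k | f k = i ∧ g k = j} = a i := by
      rw [← hfa i, card_eq_sum_card_fiberwise (f := g) (t := univ) (by simp)]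
      simp only [filter_filter]
    have hcol (j : Fin q) : ∑ i, #{k | f k = i ∧ g k = j} = b j := by
      rw [← hgb j, card_eq_sum_card_fiberwise (f := f) (t := univ) (by simp)]
      simp only [filter_filter, and_comm]
    refine ⟨fun i j => #{k | f k = i ∧ g k = j}, ⟨?_, ?_⟩, Prod.ext (funext hrow) (funext hcol)⟩
    · simpa only [hrow] using ha
    · rintro ⟨i, j⟩ hij ⟨i', j'⟩ hij' -
      obtain ⟨k, hk⟩ := card_ne_zero.1 hij
      obtain ⟨l, hl⟩ := card_ne_zero.1 hij'
      obtain ⟨rfl, rfl⟩ := (mem_filter.1 hk).2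
      obtain ⟨rfl, rfl⟩ := (mem_filter.1 hl).2
      exact (le_total k l).imp (fun h => ⟨hf h, hg h⟩) fun h => ⟨hf h, hg h⟩
end

section
/- For all integers p, q ≥ 1, M(p,q) = ((p-1)! · (q-1)! / (p+q-1)!) · c(p,q). That is, the solution of the recursion M(p,q) = ((p-1)·M(p-1,q) + (q-1)·M(p,q-1) + |p - q|) / (p + q - 1) is obtained from the integer-valued recursion c(p,q) = c(p-1,q) + c(p,q-1) + |p - q| · C(p+q-2, p-1) by multiplying by (p-1)!(q-1)!/(p+q-1)!. -/
/-- `c(p,q)`, defined by the recursion `c(p,q) = c(p-1,q) + c(p,q-1) + |p-q|·C(p+q-2,p-1)`. -/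
def cRec : ℕ → ℕ → ℕ
  | 0, _ => 0
  | _ + 1, 0 => 0
  | p + 1, q + 1 =>
      cRec p (q + 1) + cRec (p + 1) q + ((p : ℤ) - (q : ℤ)).natAbs * Nat.choose (p + q) p
termination_by p q => p + q

/-- The closed form of `Mrec` with shifted indices and cleared denominators. -/
theorem factorial_mul_Mrec_succ_succ (p q : ℕ) :
    ((p + q + 1).factorial : ℝ) * Mrec (p + 1) (q + 1) =
      (p.factorial : ℝ) * (q.factorial : ℝ) * (cRec (p + 1) (q + 1) : ℝ) := by
  have left_term : (p : ℝ) * (((p + q).factorial : ℝ) * Mrec p (q + 1)) =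
      (p.factorial : ℝ) * (q.factorial : ℝ) * (cRec p (q + 1) : ℝ) := by
    cases p with
    | zero => simp [cRec]
    | succ k =>
      have ih := factorial_mul_Mrec_succ_succ k q
      rw [show k + 1 + q = k + q + 1 by omega, ih, Nat.factorial_succ k]
      push_cast
      ring
  have right_term : (q : ℝ) * (((p + q).factorial : ℝ) * Mrec (p + 1) q) =
      (p.factorial : ℝ) * (q.factorial : ℝ) * (cRec (p + 1) q : ℝ) := by
    cases q with
    | zero => simp [cRec]
    | succ k =>
      have ih := factorial_mul_Mrec_succ_succ p k
      rw [← add_assoc, ih, Nat.factorial_succ k]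
      push_cast
      ring
  have choose_term : (((p + q).choose p : ℕ) : ℝ) * p.factorial * q.factorial =
      ((p + q).factorial : ℝ) := by
    rw [Nat.choose_symm_add]
    exact_mod_cast Nat.add_choose_mul_factorial_mul_factorial p q
  have denom_ne : (p : ℝ) + (q : ℝ) + 1 ≠ 0 := by positivity
  have Mrec_mul : ((p : ℝ) + q + 1) * Mrec (p + 1) (q + 1) =
      (p : ℝ) * Mrec p (q + 1) + (q : ℝ) * Mrec (p + 1) q + |(p : ℝ) - (q : ℝ)| := by
    rw [Mrec, mul_div_cancel₀ _ denom_ne]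
  rw [cRec, Nat.factorial_succ]
  push_cast [Nat.cast_natAbs]
  linear_combination ((p + q).factorial : ℝ) * Mrec_mul + left_term + right_term
    - |(p : ℝ) - (q : ℝ)| * choose_term
termination_by p + q

/-- `M(p,q) = ((p-1)!(q-1)!/(p+q-1)!) · c(p,q)`. -/
theorem Mrec_eq_factorial_mul_cRec (p q : ℕ) (hp : 1 ≤ p) (hq : 1 ≤ q) :
    Mrec p q =
      ((Nat.factorial (p - 1) : ℝ) * (Nat.factorial (q - 1) : ℝ) /
        (Nat.factorial (p + q - 1) : ℝ)) * (cRec p q : ℝ) := by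
  obtain ⟨p, rfl⟩ := Nat.exists_eq_add_of_le' hp
  obtain ⟨q, rfl⟩ := Nat.exists_eq_add_of_le' hq
  rw [show p + 1 + (q + 1) - 1 = p + q + 1 by omega, Nat.add_sub_cancel, Nat.add_sub_cancel,
    div_mul_eq_mul_div, eq_div_iff (by positivity), mul_comm]
  exact factorial_mul_Mrec_succ_succ p q
end

section
/- For all integers p, q ≥ 1 and all s ∈ ℕ, the number of pairs (μ,ν) ∈ C(s,p) × C(s,q) with discrete Earth Mover's Distance EMD(μ,ν) = 0 equals C(s + min(p,q) - 1, min(p,q) - 1). (This is the coefficient-wise form of the specialization H_{p,q}(0,t) = 1/(1-t)^{min(p,q)}.) -/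
/-- Compositions of the same number admit a transport plan. -/
theorem exists_transportPlan {p q s : ℕ} {μ : Fin p → ℕ} {ν : Fin q → ℕ}
    (hμ : ∑ i, μ i = s) (hν : ∑ j, ν j = s) :
    ∃ J : Fin p → Fin q → ℕ, (∀ i, ∑ j, J i j = μ i) ∧ ∀ j, ∑ i, J i j = ν j := by
  obtain ⟨e⟩ : Nonempty ((Σ i, Fin (μ i)) ≃ Σ j, Fin (ν j)) :=
    Fintype.card_eq.mp (by simp [hμ, hν])
  refine ⟨fun i j => Fintype.card {k : Fin (μ i) // (e ⟨i, k⟩).1 = j},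
    fun i => ?_, fun j => ?_⟩
  · rw [← Fintype.card_sigma, Fintype.card_congr (Equiv.sigmaFiberEquiv _), Fintype.card_fin]
  · have e₁ : (Σ i, {k : Fin (μ i) // (e ⟨i, k⟩).1 = j}) ≃
        {x : Σ i, Fin (μ i) // (e x).1 = j} :=
      ⟨fun x => ⟨⟨x.1, x.2.1⟩, x.2.2⟩, fun x => ⟨x.1.1, x.1.2, x.2⟩,
        fun _ => rfl, fun _ => rfl⟩
    rw [← Fintype.card_sigma, Fintype.card_congr e₁,
      Fintype.card_congr (e.subtypeEquiv (q := fun y => y.1 = j) fun _ => Iff.rfl),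
      Fintype.card_congr (Equiv.sigmaSubtype j), Fintype.card_fin]

theorem discCost_eq_zero_iff {p q : ℕ} {J : Fin p → Fin q → ℕ} :
    discCost J = 0 ↔ ∀ (i : Fin p) (j : Fin q), (i : ℕ) ≠ j → J i j = 0 := by
  simp only [discCost, Finset.sum_eq_zero_iff, Finset.mem_univ, true_imp_iff, mul_eq_zero,
    Int.natAbs_eq_zero, sub_eq_zero, Nat.cast_inj, or_iff_not_imp_left, ne_eq]

/-- Extension of a tuple of length `m` by zeros to a tuple of length `n`. -/
def zeroExtend {m n : ℕ} (h : m ≤ n) (a : Fin m → ℕ) (i : Fin n) : ℕ :=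
  ∑ k, if i = Fin.castLE h k then a k else 0

theorem zeroExtend_castLE {m n : ℕ} (h : m ≤ n) (a : Fin m → ℕ) (k : Fin m) :
    zeroExtend h a (Fin.castLE h k) = a k := by
  simp [zeroExtend]

theorem sum_zeroExtend {m n : ℕ} (h : m ≤ n) (a : Fin m → ℕ) :
    ∑ i, zeroExtend h a i = ∑ k, a k := by
  simp only [zeroExtend]
  rw [Finset.sum_comm]
  simp

/-- The plan carrying `a` on the diagonal. -/
def diagPlan {m p q : ℕ} (hp : m ≤ p) (hq : m ≤ q) (a : Fin m → ℕ) (i : Fin p) (j : Fin q) : ℕ :=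
  ∑ k, if i = Fin.castLE hp k then (if j = Fin.castLE hq k then a k else 0) else 0

theorem sum_diagPlan_right {m p q : ℕ} (hp : m ≤ p) (hq : m ≤ q) (a : Fin m → ℕ) (i : Fin p) :
    ∑ j, diagPlan hp hq a i j = zeroExtend hp a i := by
  simp only [diagPlan, zeroExtend]
  rw [Finset.sum_comm]
  refine Finset.sum_congr rfl fun k _ => ?_
  split_ifs <;> simp

theorem sum_diagPlan_left {m p q : ℕ} (hp : m ≤ p) (hq : m ≤ q) (a : Fin m → ℕ) (j : Fin q) :
    ∑ i, diagPlan hp hq a i j = zeroExtend hq a j := by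
  simp only [diagPlan, zeroExtend]
  rw [Finset.sum_comm]
  simp

theorem discCost_diagPlan {m p q : ℕ} (hp : m ≤ p) (hq : m ≤ q) (a : Fin m → ℕ) :
    discCost (diagPlan hp hq a) = 0 := by
  rw [discCost_eq_zero_iff]
  intro i j hij
  refine Finset.sum_eq_zero fun k _ => ?_
  split_ifs with h₁ h₂
  · subst h₁ h₂
    exact absurd rfl hij
  · rfl
  · rfl

theorem eq_diagPlan_of_discCost_eq_zero {p q : ℕ} {J : Fin p → Fin q → ℕ} (hJ : discCost J = 0) :
    J = diagPlan (min_le_left p q) (min_le_right p q)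
      (fun k => J (Fin.castLE (min_le_left p q) k) (Fin.castLE (min_le_right p q) k)) := by
  rw [discCost_eq_zero_iff] at hJ
  funext i j
  by_cases hij : (i : ℕ) = j
  · have hk : (i : ℕ) < min p q := lt_min i.2 (hij ▸ j.2)
    rw [diagPlan, Finset.sum_eq_single ⟨i, hk⟩]
    · rw [if_pos (by rfl), if_pos (Fin.ext hij.symm)]
      exact congrArg (J i) (Fin.ext hij.symm)
    · intro k _ hki
      rw [if_neg]
      rintro rfl
      exact hki rfl
    · simp
  · rw [hJ i j hij, discCost_eq_zero_iff.mp (discCost_diagPlan _ _ _) i j hij]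

theorem discEMD_eq_zero_iff {p q s : ℕ} {μ : Fin p → ℕ} {ν : Fin q → ℕ}
    (hμ : ∑ i, μ i = s) (hν : ∑ j, ν j = s) :
    discEMD μ ν = 0 ↔ ∃ a : Fin (min p q) → ℕ,
      zeroExtend (min_le_left p q) a = μ ∧ zeroExtend (min_le_right p q) a = ν := by
  rw [discEMD, Nat.sInf_eq_zero]
  constructor
  · rintro (⟨J, hrow, hcol, hJ⟩ | hempty)
    · rw [eq_diagPlan_of_discCost_eq_zero hJ.symm] at hrow hcol
      simp only [sum_diagPlan_right, sum_diagPlan_left] at hrow hcol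
      exact ⟨_, funext hrow, funext hcol⟩
    · obtain ⟨J, hrow, hcol⟩ := exists_transportPlan hμ hν
      exact (Set.eq_empty_iff_forall_notMem.mp hempty _ ⟨J, hrow, hcol, rfl⟩).elim
  · rintro ⟨a, rfl, rfl⟩
    exact Or.inl ⟨diagPlan _ _ a, sum_diagPlan_right _ _ a, sum_diagPlan_left _ _ a,
      (discCost_diagPlan _ _ a).symm⟩

theorem card_antidiagonalTuple {m : ℕ} (hm : 1 ≤ m) (s : ℕ) :
    (Finset.Nat.antidiagonalTuple m s).card = Nat.choose (s + m - 1) (m - 1) := by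
  have h := Finset.card_finsuppAntidiag_nat_eq_choose (s := (Finset.univ : Finset (Fin m))) s
  rw [Finset.finsuppAntidiag, Finset.card_map, Finset.card_attach,
    Finset.piAntidiag_univ_fin_eq_antidiagonalTuple, Finset.card_univ, Fintype.card_fin] at h
  rw [h, add_comm m s]
  exact Nat.choose_symm_of_eq_add (by lia)

/-- The number of pairs of compositions of `s` with discrete EMD zero equals
`C(s + min p q - 1, min p q - 1)`. -/
theorem card_EMD_zero (p q s : ℕ) (hp : 1 ≤ p) (hq : 1 ≤ q) :
    ((Finset.Nat.antidiagonalTuple p s ×ˢ Finset.Nat.antidiagonalTuple q s).filter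
        (fun x => discEMD x.1 x.2 = 0)).card =
      Nat.choose (s + min p q - 1) (min p q - 1) := by
  rw [← card_antidiagonalTuple (le_min hp hq)]
  symm
  refine Finset.card_bij (fun a _ => (zeroExtend (min_le_left p q) a,
    zeroExtend (min_le_right p q) a)) ?_ ?_ ?_
  · intro a ha
    rw [Finset.Nat.mem_antidiagonalTuple] at ha
    have hμ := (sum_zeroExtend (min_le_left p q) a).trans ha
    have hν := (sum_zeroExtend (min_le_right p q) a).trans ha
    simp only [Finset.mem_filter, Finset.mem_product, Finset.Nat.mem_antidiagonalTuple]
    exact ⟨⟨hμ, hν⟩, (discEMD_eq_zero_iff hμ hν).mpr ⟨a, rfl, rfl⟩⟩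
  · intro a _ b _ hab
    funext k
    rw [← zeroExtend_castLE (min_le_left p q) a k, (Prod.mk.inj hab).1, zeroExtend_castLE]
  · rintro ⟨μ, ν⟩ h
    simp only [Finset.mem_filter, Finset.mem_product, Finset.Nat.mem_antidiagonalTuple] at h
    obtain ⟨⟨hμ, hν⟩, h⟩ := h
    obtain ⟨a, rfl, rfl⟩ := (discEMD_eq_zero_iff hμ hν).mp h
    exact ⟨a, Finset.Nat.mem_antidiagonalTuple.mpr ((sum_zeroExtend _ a).symm.trans hμ), rfl⟩
end

section
/- For all integers p, q ≥ 1 and all s ∈ ℕ: C(s+p-1, p-1) · C(s+q-1, q-1) = Σ_{i=0}^{min(p-1, q-1, s)} C(p-1, i) · C(q-1, i) · C(s - i + p + q - 2, p + q - 2). (This is the coefficient-wise form of the identity H_{p,q}(1,t) = (Σ_i C(p-1,i)C(q-1,i) t^i) / (1-t)^{p+q-1} for the Hilbert series of the rank-at-most-one p × q matrices.) -/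
open Finset in
/-- Vandermonde identity with the summation truncated to a range that still contains
`0, …, n`. -/
lemma Nat.add_choose_eq_sum_range {m n k N : ℕ} (hn : n ≤ N) (hk : N ≤ k) :
    (n + m).choose k = ∑ j ∈ range (N + 1), n.choose j * m.choose (k - j) := by
  rw [Nat.add_choose_eq, Nat.sum_antidiagonal_eq_sum_range_succ_mk]
  refine (sum_subset (range_mono (by omega)) fun j _ hj => ?_).symm
  rw [Nat.choose_eq_zero_of_lt (by simp at hj; omega), zero_mul]

open Finset in
lemma Nat.sum_choose_mul_choose {a n N : ℕ} (hn : n ≤ N) :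
    ∑ i ∈ range (N + 1), a.choose i * n.choose i = (a + n).choose a := by
  rw [Nat.choose_symm_add, Nat.add_choose_eq, Nat.sum_antidiagonal_eq_sum_range_succ_mk]
  refine (sum_subset (range_mono (by omega)) fun j _ hj => ?_).symm.trans
    (sum_congr rfl fun j hj => ?_)
  · rw [Nat.choose_eq_zero_of_lt (n := n) (by simpa using hj), mul_zero]
  · rw [Nat.choose_symm (by simpa [Nat.lt_succ_iff] using hj)]

lemma Nat.add_choose_mul_choose (s a j : ℕ) :
    (s + a).choose a * s.choose j = (s + a).choose (a + j) * (a + j).choose a := by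
  simpa using (Nat.choose_mul (n := s + a) (k := a + j) (s := a) (by omega)).symm

open Finset in
lemma Nat.add_choose_mul_add_choose (a b s : ℕ) :
    (s + a).choose a * (s + b).choose b =
      ∑ i ∈ range (b + 1), a.choose i * b.choose i * (b - i + (s + a)).choose (a + b) := by
  have hL : (s + a).choose a * (s + b).choose b = ∑ k ∈ range (b + 1),
      b.choose k * ((s + a).choose (a + b - k) * (a + (b - k)).choose a) := by
    rw [add_comm s b, Nat.add_choose_eq_sum_range le_rfl le_rfl, mul_sum]
    refine sum_congr rfl fun k hk => ?_
    have hk : k ≤ b := by simpa [Nat.lt_succ_iff] using hk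
    rw [Nat.add_sub_assoc hk, ← Nat.add_choose_mul_choose]
    ring
  have hR : ∀ i ∈ range (b + 1),
      a.choose i * b.choose i * (b - i + (s + a)).choose (a + b) = ∑ k ∈ range (b + 1),
        b.choose k * ((s + a).choose (a + b - k) * (a.choose i * (b - k).choose i)) := by
    intro i _
    rw [Nat.add_choose_eq_sum_range (Nat.sub_le b i) (Nat.le_add_left b a), mul_sum]
    refine sum_congr rfl fun k _ => ?_
    have h : b.choose i * (b - i).choose k = b.choose k * (b - k).choose i := by
      have h₁ := Nat.choose_mul (n := b) (k := i + k) (s := i) (by omega)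
      have h₂ := Nat.choose_mul (n := b) (k := i + k) (s := k) (by omega)
      rw [Nat.add_sub_cancel_left] at h₁
      rw [Nat.add_sub_cancel] at h₂
      rw [← h₁, ← h₂, Nat.choose_symm_add]
    linear_combination a.choose i * (s + a).choose (a + b - k) * h
  rw [hL, sum_congr rfl hR, sum_comm]
  refine sum_congr rfl fun k _ => ?_
  rw [← mul_sum, ← mul_sum, Nat.sum_choose_mul_choose (Nat.sub_le b k)]


/-- Coefficient-wise form of the Hilbert series identity
`H_{p,q}(1,t) = (Σ_i C(p-1,i)C(q-1,i) t^i)/(1-t)^{p+q-1}` for the rank-at-most-one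
`p × q` matrices. -/
theorem choose_mul_choose_eq_sum (p q s : ℕ) (hp : 1 ≤ p) (hq : 1 ≤ q) :
    Nat.choose (s + p - 1) (p - 1) * Nat.choose (s + q - 1) (q - 1) =
      ∑ i ∈ Finset.range (min (min (p - 1) (q - 1)) s + 1),
        Nat.choose (p - 1) i * Nat.choose (q - 1) i *
          Nat.choose (s - i + p + q - 2) (p + q - 2) := by
  obtain ⟨a, rfl⟩ := Nat.exists_eq_add_of_le' hp
  obtain ⟨b, rfl⟩ := Nat.exists_eq_add_of_le' hq
  have hab : a + 1 + (b + 1) - 2 = a + b := by omega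
  simp only [← add_assoc s, Nat.add_sub_cancel, hab]
  rw [Nat.add_choose_mul_add_choose]
  symm
  refine (Finset.sum_congr rfl fun i hi => ?_).trans
    (Finset.sum_subset (Finset.range_mono (by omega)) fun i hb hi => ?_)
  · rw [Finset.mem_range] at hi
    congr 2
    omega
  · rw [Finset.mem_range] at hb hi
    rcases lt_or_ge a i with h | h
    · simp [Nat.choose_eq_zero_of_lt h]
    · rw [Nat.choose_eq_zero_of_lt (n := b - i + (s + a)) (by omega), mul_zero]
end

section
/- Let n ≥ 1 and let J : Fin n → Fin n → ℝ be a matrix with all entries ≥ 0 whose support is a chain in Fin n × Fin n under the componentwise partial order. Let μ j = Σ_i J i j be the column sums and ν i = Σ_j J i j the row sums. Then Σ_{i,j} |i - j| · J i j = E(μ - ν); that is, the transport cost of a joint distribution supported on a chain equals the sum of the absolute values of the partial sums of the difference of its marginals. -/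
/-- `E(v)`: the sum of the absolute values of the partial sums of `v`. -/
noncomputable def Esum {n : ℕ} (v : Fin n → ℝ) : ℝ :=
  ∑ k : Fin n, |∑ i ∈ Finset.Iic k, v i|

open Finset in
/-- The number of thresholds `k` separating `i` from `j` is `|i - j|`. -/
lemma sum_abs_indicator_sub_s16 {n : ℕ} (i j : Fin n) :
    ∑ k : Fin n, |(if j ≤ k then (1 : ℝ) else 0) - (if i ≤ k then 1 else 0)| =
      (((i : ℤ) - (j : ℤ)).natAbs : ℝ) := by
  wlog hij : i ≤ j generalizing i j
  · rw [← neg_sub (j : ℤ), Int.natAbs_neg, ← this j i (le_of_not_ge hij)]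
    exact sum_congr rfl fun k _ => abs_sub_comm _ _
  have hk (k : Fin n) : |(if j ≤ k then (1 : ℝ) else 0) - (if i ≤ k then 1 else 0)| =
      if k ∈ Ico i j then 1 else 0 := by
    simp only [mem_Ico]
    split_ifs <;> first | omega | simp
  simp_rw [hk]
  rw [sum_boole, filter_univ_mem, Fin.card_Ico]
  congr 1
  omega

/-- A partial sum of the difference of the marginals, as a sum over the whole matrix. -/
lemma sum_Iic_marginal_sub {n : ℕ} (J : Fin n → Fin n → ℝ) (k : Fin n) :
    ∑ l ∈ Finset.Iic k, ((∑ i, J i l) - (∑ j, J l j)) =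
      ∑ p : Fin n × Fin n,
        ((if p.2 ≤ k then (1 : ℝ) else 0) - (if p.1 ≤ k then 1 else 0)) * J p.1 p.2 := by
  have hIic (f : Fin n → ℝ) :
      ∑ l ∈ Finset.Iic k, f l = ∑ l, (if l ≤ k then (1 : ℝ) else 0) * f l := by
    simp only [ite_mul, one_mul, zero_mul, ← Finset.sum_filter]
    congr 1
    ext l
    simp
  simp_rw [Finset.sum_sub_distrib, hIic, sub_mul, Finset.sum_sub_distrib, Fintype.sum_prod_type,
    Finset.mul_sum]
  rw [Finset.sum_comm]

lemma abs_sum_eq_sum_abs_of_same_sign {ι : Type*} {s : Finset ι} {f : ι → ℝ}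
    (h : (∀ i ∈ s, 0 ≤ f i) ∨ ∀ i ∈ s, f i ≤ 0) : |∑ i ∈ s, f i| = ∑ i ∈ s, |f i| := by
  obtain h | h := h
  · exact Finset.abs_sum_of_nonneg h |>.trans
      (Finset.sum_congr rfl fun i hi => (abs_of_nonneg (h i hi)).symm)
  · rw [abs_of_nonpos (Finset.sum_nonpos h), ← Finset.sum_neg_distrib]
    exact Finset.sum_congr rfl fun i hi => (abs_of_nonpos (h i hi)).symm

/-- Across a fixed threshold, a plan supported on a chain moves mass in one direction only. -/
lemma same_sign_of_chain_support {n : ℕ} {J : Fin n → Fin n → ℝ} (hpos : ∀ i j, 0 ≤ J i j)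
    (hchain : IsChain (· ≤ ·) {x : Fin n × Fin n | J x.1 x.2 ≠ 0}) (k : Fin n) :
    (∀ p ∈ (Finset.univ : Finset (Fin n × Fin n)),
      0 ≤ ((if p.2 ≤ k then (1 : ℝ) else 0) - (if p.1 ≤ k then 1 else 0)) * J p.1 p.2) ∨
    ∀ p ∈ (Finset.univ : Finset (Fin n × Fin n)),
      ((if p.2 ≤ k then (1 : ℝ) else 0) - (if p.1 ≤ k then 1 else 0)) * J p.1 p.2 ≤ 0 := by
  by_contra! h
  obtain ⟨⟨p, -, hp⟩, q, -, hq⟩ := h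
  have hp0 : J p.1 p.2 ≠ 0 := fun h0 => by simp [h0] at hp
  have hq0 : J q.1 q.2 ≠ 0 := fun h0 => by simp [h0] at hq
  have hp' : p.1 ≤ k ∧ ¬ p.2 ≤ k := by
    have := hpos p.1 p.2
    split_ifs at hp <;> first | (constructor <;> assumption) | (exfalso; linarith)
  have hq' : q.2 ≤ k ∧ ¬ q.1 ≤ k := by
    have := hpos q.1 q.2
    split_ifs at hq <;> first | (constructor <;> assumption) | (exfalso; linarith)
  rcases hchain.total hp0 hq0 with hle | hle
  · exact hp'.2 (hle.2.trans hq'.1)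
  · exact hq'.2 (hle.1.trans hp'.1)

/-- The transport cost of a nonnegative joint distribution whose support is a chain equals
the sum of the absolute values of the partial sums of the difference of its marginals
(column sums minus row sums). -/
theorem rcost_of_chain_support (n : ℕ) (hn : 1 ≤ n) (J : Fin n → Fin n → ℝ)
    (hpos : ∀ i j, 0 ≤ J i j)
    (hchain : IsChain (· ≤ ·) {x : Fin n × Fin n | J x.1 x.2 ≠ 0}) :
    rcost J = Esum (fun k => (∑ i, J i k) - (∑ j, J k j)) := by
  have habs (k : Fin n) :
      |∑ l ∈ Finset.Iic k, ((∑ i, J i l) - (∑ j, J l j))| = ∑ p : Fin n × Fin n,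
        |(if p.2 ≤ k then (1 : ℝ) else 0) - (if p.1 ≤ k then 1 else 0)| * J p.1 p.2 := by
    rw [sum_Iic_marginal_sub,
      abs_sum_eq_sum_abs_of_same_sign (same_sign_of_chain_support hpos hchain k)]
    exact Finset.sum_congr rfl fun p _ => by rw [abs_mul, abs_of_nonneg (hpos p.1 p.2)]
  simp_rw [Esum, habs]
  rw [Finset.sum_comm]
  simp_rw [← Finset.sum_mul, sum_abs_indicator_sub_s16, Fintype.sum_prod_type]
  rfl
end
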